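/- (Krein's theorem) Let H and H₀ be bounded self-adjoint operators on a separable complex Hilbert space ℋ such that V = H − H₀ is trace class, and let [a,b] ⊂ ℝ contain σ(H) ∪ σ(H₀). Then there exists a unique function ξ ∈ L¹(ℝ), supported in [a,b], such that for every φ that is either in C¹₁([a,b]) or a polynomial, φ(H) − φ(H₀) is trace class and Tr(φ(H) − φ(H₀)) = ∫_a^b φ′(λ) ξ(λ) dλ. Moreover ∫_a^b |ξ(λ)| dλ ≤ ‖V‖₁, ∫_a^b ξ(λ) dλ = Tr(V), and if V is a positive (resp. negative) trace-class operator then ξ(λ) ≥ 0 (resp. ≤ 0) for almost all λ ∈ [a,b]. -/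

import Mathlib

open scoped InnerProductSpace
open MeasureTheory Polynomial

namespace HHCP

variable {H : Type*} [NormedAddCommGroup H] [InnerProductSpace ℂ H] [CompleteSpace H]
  [TopologicalSpace.SeparableSpace H]

/-- `f(A)` for a function `f` of a real variable, applied to the (selfadjoint, hence
star-normal) bounded operator `A` via the continuous functional calculus. -/
noncomputable def fc (f : ℝ → ℂ) (A : H →L[ℂ] H) : H →L[ℂ] H :=
  cfc (fun z : ℂ => f z.re) A

/-- `|A| = √(A⋆A)`. -/
noncomputable def absOp (A : H →L[ℂ] H) : H →L[ℂ] H :=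
  cfc Real.sqrt (ContinuousLinearMap.adjoint A * A)

/-- `A` is of trace class, i.e. `∑ ⟪eᵢ, |A| eᵢ⟫ < ∞` (this is independent of the
choice of the Hilbert basis `e`). -/
def IsTraceClass {ι : Type*} (e : HilbertBasis ι ℂ H) (A : H →L[ℂ] H) : Prop :=
  Summable fun i => (⟪e i, absOp A (e i)⟫_ℂ).re

/-- The trace norm `‖A‖₁ = Tr |A|`. -/
noncomputable def traceNorm {ι : Type*} (e : HilbertBasis ι ℂ H) (A : H →L[ℂ] H) : ℝ :=
  ∑' i, (⟪e i, absOp A (e i)⟫_ℂ).re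

/-- The trace `Tr A = ∑ᵢ ⟪eᵢ, A eᵢ⟫`. -/
noncomputable def trace {ι : Type*} (e : HilbertBasis ι ℂ H) (A : H →L[ℂ] H) : ℂ :=
  ∑' i, ⟪e i, A (e i)⟫_ℂ

/-- `T` is hyponormal (`‖T⋆x‖ ≤ ‖Tx‖`, i.e. `[T⋆,T] ≥ 0`) and *purely* so: there is no
nonzero closed subspace, invariant under `T` and `T⋆`, on which `T` is normal. -/
def PurelyHyponormal (T : H →L[ℂ] H) : Prop :=
  (∀ x : H, ‖ContinuousLinearMap.adjoint T x‖ ≤ ‖T x‖) ∧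
  ∀ S : Submodule ℂ H, IsClosed (S : Set H) →
    (∀ x ∈ S, T x ∈ S) → (∀ x ∈ S, ContinuousLinearMap.adjoint T x ∈ S) →
    (∀ x ∈ S, ‖T x‖ = ‖ContinuousLinearMap.adjoint T x‖) → S = ⊥

/-- Assumption (A): `T = X + iY` is purely hyponormal with `X, Y` selfadjoint,
`[T⋆,T] = −2i[Y,X] = 2D²` is a positive trace-class operator, and
`σ(X) ∪ σ(Y) ⊆ [a,b]`. -/
structure AssumptionA {ι : Type*} (e : HilbertBasis ι ℂ H)
    (X Y D2 : H →L[ℂ] H) (a b : ℝ) : Prop where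
  hab : a ≤ b
  hX : IsSelfAdjoint X
  hY : IsSelfAdjoint Y
  hpure : PurelyHyponormal (X + Complex.I • Y)
  hD2 : (2 : ℂ) • D2 = (-(2 : ℂ) * Complex.I) • (Y * X - X * Y)
  hpos : D2.IsPositive
  htc : IsTraceClass e D2
  hspecX : spectrum ℝ X ⊆ Set.Icc a b
  hspecY : spectrum ℝ Y ⊆ Set.Icc a b

/-- `ψ ∈ C¹₁`: `ψ(β) = (2π)^{-1/2} ∫ ψ̂(α) e^{iαβ} dα` for some `ψ̂` with
`∫ |ψ̂(α)|(1+|α|) dα < ∞`. -/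
def MemC11 (ψ : ℝ → ℂ) : Prop :=
  ∃ g : ℝ → ℂ, Integrable g ∧ Integrable (fun α : ℝ => α • g α) ∧
    ∀ β : ℝ, ψ β = (Real.sqrt (2 * Real.pi))⁻¹ •
      ∫ α : ℝ, Complex.exp (Complex.I * (α : ℂ) * (β : ℂ)) • g α

/-- `ψ` is (the function given by) a polynomial with complex coefficients. -/
def IsPolyFun (ψ : ℝ → ℂ) : Prop :=
  ∃ p : Polynomial ℂ, ∀ t : ℝ, ψ t = Polynomial.eval (t : ℂ) p

/-- `ψ` is either in `C¹₁([a,b])` or a polynomial. -/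
def GoodFun (ψ : ℝ → ℂ) : Prop := MemC11 ψ ∨ IsPolyFun ψ

/-- `E` is the spectral measure of the selfadjoint operator `A`: a projection-valued,
countably additive measure on `ℝ` such that `⟪x, f(A) x⟫ = ∫ f dμ_x`, where `μ_x` is the
finite positive measure `μ_x(Δ) = ⟪x, E(Δ) x⟫`. -/
def IsSpectralMeasureOf (A : H →L[ℂ] H) (E : Set ℝ → H →L[ℂ] H) : Prop :=
  (∀ Δ : Set ℝ, IsSelfAdjoint (E Δ)) ∧
  (∀ Δ Ω : Set ℝ, E (Δ ∩ Ω) = E Δ * E Ω) ∧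
  E Set.univ = 1 ∧
  (∀ Δ : ℕ → Set ℝ, (∀ n, MeasurableSet (Δ n)) → Pairwise (Function.onFun Disjoint Δ) →
    ∀ x : H, HasSum (fun n => E (Δ n) x) (E (⋃ n, Δ n) x)) ∧
  ∀ x : H, ∃ μ : Measure ℝ, IsFiniteMeasure μ ∧
    (∀ Δ : Set ℝ, MeasurableSet Δ → (μ Δ).toReal = (⟪x, E Δ x⟫_ℂ).re) ∧
    ∀ f : ℝ → ℝ, Continuous f → (⟪x, cfc f A x⟫_ℂ).re = ∫ t, f t ∂μ

/-- An indefinite integral `𝒥(χ_Δ)` of the characteristic function of `Δ`. -/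
noncomputable def Jind (a : ℝ) (Δ : Set ℝ) (t : ℝ) : ℝ :=
  ∫ s in a..t, Set.indicator Δ (fun _ => (1 : ℝ)) s

/-- `𝒥(χ_Δ)(A)`. -/
noncomputable def JindOp (a : ℝ) (Δ : Set ℝ) (A : H →L[ℂ] H) : H →L[ℂ] H :=
  fc (fun t => (Jind a Δ t : ℂ)) A

/-- `ψ ∈ C¹([a,b])` with derivative `ψd` on `[a,b]`. -/
def HasDerivOnIcc (ψ ψd : ℝ → ℂ) (a b : ℝ) : Prop :=
  (∀ t ∈ Set.Icc a b, HasDerivWithinAt ψ (ψd t) (Set.Icc a b) t) ∧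
  ContinuousOn ψd (Set.Icc a b)

/-- `r` is a Carey–Pincus principal function for the pair `X, Y`: a nonnegative
`L¹([a,b]²)` function with `Tr(−i[ψ(Y), φ(X)]) = ∫∫ φ′(t) ψ′(λ) r(t,λ) dt dλ`
for all `ψ, φ ∈ C¹([a,b])`. -/
def IsPrincipalFunction {ι : Type*} (e : HilbertBasis ι ℂ H) (X Y : H →L[ℂ] H)
    (a b : ℝ) (r : ℝ → ℝ → ℝ) : Prop :=
  IntegrableOn (fun q : ℝ × ℝ => r q.1 q.2) (Set.Icc a b ×ˢ Set.Icc a b) ∧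
  (∀ᵐ q : ℝ × ℝ ∂(volume : Measure (ℝ × ℝ)),
    q ∈ Set.Icc a b ×ˢ Set.Icc a b → 0 ≤ r q.1 q.2) ∧
  ∀ ψ ψd φ φd : ℝ → ℂ, HasDerivOnIcc ψ ψd a b → HasDerivOnIcc φ φd a b →
    trace e ((-Complex.I) • (fc ψ Y * fc φ X - fc φ X * fc ψ Y)) =
      ∫ t in Set.Icc a b, ∫ l in Set.Icc a b, φd t * ψd l * (r t l : ℂ)

/-- The Jacobian `J(F,G)(t,λ) = ∂F/∂t ∂G/∂λ − ∂F/∂λ ∂G/∂t`. -/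
noncomputable def Jac (F G : ℝ → ℝ → ℂ) (t l : ℝ) : ℂ :=
  deriv (fun s => F s l) t * deriv (fun s => G t s) l -
    deriv (fun s => F t s) l * deriv (fun s => G s l) t

section K1
set_option linter.unusedSectionVars false
set_option linter.unusedSimpArgs false
set_option linter.deprecated false
open Filter Topology
variable {H : Type*} [NormedAddCommGroup H] [InnerProductSpace ℂ H] [CompleteSpace H]

/-- A bound for the trace norm, in a form which is stable under limits. -/
def NB {ι : Type*} (e : HilbertBasis ι ℂ H) (T : H →L[ℂ] H) (M : ℝ) : Prop :=
  ∀ C D : H →L[ℂ] H, ‖C‖ ≤ 1 → ‖D‖ ≤ 1 → ∀ s : Finset ι,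
    ‖∑ i ∈ s, ⟪e i, C (T (D (e i)))⟫_ℂ‖ ≤ M

/-- The trace of `T` exists and is equal to `t`. -/
def HasTr {ι : Type*} (e : HilbertBasis ι ℂ H) (T : H →L[ℂ] H) (t : ℂ) : Prop :=
  HasSum (fun i => ⟪e i, T (e i)⟫_ℂ) t

/-- `V` is (weakly) the sum of `σ k |u k⟩⟨u k|`. -/
structure Rep {κ : Type*} (V : H →L[ℂ] H) (u : κ → H) (σ : κ → ℝ) : Prop where
  sm : Summable fun k => ‖u k‖ ^ 2
  sg : ∀ k, |σ k| ≤ 1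
  hs : ∀ x y, HasSum (fun k => (σ k : ℂ) * (⟪x, u k⟫_ℂ * ⟪u k, y⟫_ℂ)) ⟪x, V y⟫_ℂ

/-- `Tr (V B)`. -/
noncomputable def tau {κ : Type*} (u : κ → H) (σ : κ → ℝ) (B : H →L[ℂ] H) : ℂ :=
  ∑' k, (σ k : ℂ) * ⟪u k, B (u k)⟫_ℂ

variable {ι : Type*} {e : HilbertBasis ι ℂ H}

lemma NB.nonneg {T : H →L[ℂ] H} {M : ℝ} (h : NB e T M) : 0 ≤ M := by
  simpa using h 0 0 (by simp) (by simp) ∅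

lemma NB.mono {T : H →L[ℂ] H} {M M' : ℝ} (h : NB e T M) (hM : M ≤ M') : NB e T M' :=
  fun C D hC hD s => (h C D hC hD s).trans hM

lemma NB.zero : NB e (0 : H →L[ℂ] H) 0 := by
  intro C D hC hD s; simp

lemma NB.add {T S : H →L[ℂ] H} {M N : ℝ} (h : NB e T M) (h' : NB e S N) :
    NB e (T + S) (M + N) := by
  intro C D hC hD s
  have : ∑ i ∈ s, ⟪e i, C ((T + S) (D (e i)))⟫_ℂ =
    ∑ i ∈ s, ⟪e i, C (T (D (e i)))⟫_ℂ + ∑ i ∈ s, ⟪e i, C (S (D (e i)))⟫_ℂ := by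
    rw [← Finset.sum_add_distrib]
    simp [inner_add_right]
  rw [this]
  exact (norm_add_le _ _).trans (add_le_add (h C D hC hD s) (h' C D hC hD s))

lemma NB.smul {T : H →L[ℂ] H} {M : ℝ} (h : NB e T M) (c : ℂ) :
    NB e (c • T) (‖c‖ * M) := by
  intro C D hC hD s
  have : ∑ i ∈ s, ⟪e i, C ((c • T) (D (e i)))⟫_ℂ =
    c * ∑ i ∈ s, ⟪e i, C (T (D (e i)))⟫_ℂ := by
    rw [Finset.mul_sum]
    simp [inner_smul_right]
  rw [this, norm_mul]
  exact mul_le_mul_of_nonneg_left (h C D hC hD s) (norm_nonneg _)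

lemma NB.sum {α : Type*} (t : Finset α) {T : α → H →L[ℂ] H} {M : α → ℝ}
    (h : ∀ a ∈ t, NB e (T a) (M a)) : NB e (∑ a ∈ t, T a) (∑ a ∈ t, M a) := by
  classical
  induction t using Finset.induction_on with
  | empty => simpa using NB.zero
  | insert a t ha ih =>
    rw [Finset.sum_insert ha, Finset.sum_insert ha]
    exact (h a (by simp)).add (ih fun b hb => h b (by simp [hb]))

lemma exists_contr (X : H →L[ℂ] H) : ∃ Y : H →L[ℂ] H, ‖Y‖ ≤ 1 ∧ X = (‖X‖ : ℂ) • Y := by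
  by_cases hX : X = 0
  · exact ⟨0, by simp, by simp [hX]⟩
  · have : ‖X‖ ≠ 0 := by simpa using hX
    refine ⟨(‖X‖ : ℂ)⁻¹ • X, ?_, ?_⟩
    · rw [norm_smul]; simp [this]
    · rw [smul_smul, mul_inv_cancel₀, one_smul]; exact_mod_cast this

lemma NB.mul {T : H →L[ℂ] H} {M : ℝ} (h : NB e T M) (X Y : H →L[ℂ] H) :
    NB e (X * T * Y) (‖X‖ * ‖Y‖ * M) := by
  obtain ⟨X', hX', hX⟩ := exists_contr X
  obtain ⟨Y', hY', hY⟩ := exists_contr Y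
  have h1 : NB e (X' * T * Y') M := by
    intro C D hC hD s
    have := h (C * X') (Y' * D) ?_ ?_ s
    · simpa using this
    · exact (norm_mul_le _ _).trans (mul_le_one₀ hC (norm_nonneg _) hX')
    · exact (norm_mul_le _ _).trans (mul_le_one₀ hY' (norm_nonneg _) hD)
  have h2 := (h1.smul ((‖X‖ : ℂ) * (‖Y‖ : ℂ)))
  have e1 : X * T * Y = ((‖X‖ : ℂ) * (‖Y‖ : ℂ)) • (X' * T * Y') := by
    conv_lhs => rw [hX, hY]
    simp only [smul_mul_assoc, mul_smul_comm, smul_smul]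
    rw [mul_comm]
  rw [e1]
  simpa using h2

lemma NB.pow {X1 X0 : H →L[ℂ] H} {S M : ℝ} (h : NB e (X1 - X0) S) (hM0 : 0 ≤ M)
    (h1 : ‖X1‖ ≤ M) (h0 : ‖X0‖ ≤ M) (n : ℕ) :
    NB e (X1 ^ n - X0 ^ n) (n * M ^ (n - 1) * S) := by
  have hS := h.nonneg
  induction n with
  | zero => simpa using NB.zero
  | succ n ih =>
    have e1 : X1 ^ (n + 1) - X0 ^ (n + 1)
      = X1 * (X1 ^ n - X0 ^ n) * 1 + 1 * (X1 - X0) * X0 ^ n := by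
      simp only [pow_succ' X1, pow_succ' X0]; noncomm_ring
    rw [e1]
    have hone : ‖(1 : H →L[ℂ] H)‖ ≤ 1 := ContinuousLinearMap.norm_id_le
    have hp : ‖X0 ^ n‖ ≤ M ^ n := by
      rcases Nat.eq_zero_or_pos n with rfl | hn
      · simpa using hone
      · exact (norm_pow_le' _ hn).trans (pow_le_pow_left₀ (norm_nonneg _) h0 n)
    refine ((ih.mul X1 1).add (h.mul 1 (X0 ^ n))).mono ?_
    have b1 : ‖X1‖ * ‖(1 : H →L[ℂ] H)‖ * (n * M ^ (n - 1) * S) ≤ M * 1 * (n * M ^ (n - 1) * S) := by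
      gcongr
    have b2 : ‖(1 : H →L[ℂ] H)‖ * ‖X0 ^ n‖ * S ≤ 1 * M ^ n * S := by gcongr
    refine (add_le_add b1 b2).trans (le_of_eq ?_)
    rcases Nat.eq_zero_or_pos n with rfl | hn
    · simp
    · obtain ⟨m, rfl⟩ : ∃ m, n = m + 1 := ⟨n - 1, by omega⟩
      simp only [Nat.add_sub_cancel]
      push_cast
      ring

lemma bessel2 (e : HilbertBasis ι ℂ H) (x y : H) (s : Finset ι) :
    ∑ i ∈ s, ‖⟪x, e i⟫_ℂ‖ * ‖⟪e i, y⟫_ℂ‖ ≤ ‖x‖ * ‖y‖ := by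
  have h1 := Real.sum_mul_le_sqrt_mul_sqrt s (fun i => ‖⟪x, e i⟫_ℂ‖) (fun i => ‖⟪e i, y⟫_ℂ‖)
  refine h1.trans ?_
  gcongr
  · rw [Real.sqrt_le_left (norm_nonneg _)]
    have := e.orthonormal.sum_inner_products_le (x := x) (s := s)
    simpa [norm_inner_symm] using this
  · rw [Real.sqrt_le_left (norm_nonneg _)]
    exact e.orthonormal.sum_inner_products_le (x := y) (s := s)

lemma bessel2_sm (e : HilbertBasis ι ℂ H) (x y : H) :
    Summable (fun i => ‖⟪x, e i⟫_ℂ‖ * ‖⟪e i, y⟫_ℂ‖) :=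
  summable_of_sum_le (fun i => by positivity) (bessel2 e x y)

lemma bessel2_tsum (e : HilbertBasis ι ℂ H) (x y : H) :
    ∑' i, ‖⟪x, e i⟫_ℂ‖ * ‖⟪e i, y⟫_ℂ‖ ≤ ‖x‖ * ‖y‖ :=
  (bessel2_sm e x y).tsum_le_of_sum_le (bessel2 e x y)

lemma double_sm {κ : Type*} (e : HilbertBasis ι ℂ H) (x y : κ → H)
    (hs : Summable fun k => ‖x k‖ * ‖y k‖) :
    Summable (fun q : κ × ι => ‖⟪x q.1, e q.2⟫_ℂ‖ * ‖⟪e q.2, y q.1⟫_ℂ‖) := by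
  refine (summable_prod_of_nonneg ?_).2 ⟨fun k => bessel2_sm e (x k) (y k), ?_⟩
  · intro q
    exact mul_nonneg (norm_nonneg _) (norm_nonneg _)
  · refine Summable.of_nonneg_of_le (fun k => ?_) (fun k => bessel2_tsum e (x k) (y k)) hs
    exact tsum_nonneg fun i => mul_nonneg (norm_nonneg _) (norm_nonneg _)

variable {κ : Type*} {V : H →L[ℂ] H} {u : κ → H} {σ : κ → ℝ}

lemma Rep.hasTr (h : Rep V u σ) (B C : H →L[ℂ] H) :
    HasTr e (B * V * C) (tau u σ (C * B)) := by
  -- the double family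
  let f : κ × ι → ℂ := fun q => (σ q.1 : ℂ) *
    (⟪ContinuousLinearMap.adjoint C (u q.1), e q.2⟫_ℂ * ⟪e q.2, B (u q.1)⟫_ℂ)
  have hf : Summable f := by
    have hg := double_sm e (fun k => ContinuousLinearMap.adjoint C (u k)) (fun k => B (u k)) (by
      refine Summable.of_nonneg_of_le (fun k => by positivity) (fun k => ?_)
        (h.sm.mul_left (‖ContinuousLinearMap.adjoint C‖ * ‖B‖))
      have h1 := (ContinuousLinearMap.adjoint C).le_opNorm (u k)
      have h2 := B.le_opNorm (u k)
      refine (mul_le_mul h1 h2 (norm_nonneg _) (by positivity)).trans (le_of_eq ?_)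
      ring)
    refine Summable.of_norm_bounded hg fun q => ?_
    simp only [f, norm_mul]
    have := h.sg q.1
    have h2 : ‖(σ q.1 : ℂ)‖ ≤ 1 := by simpa using this
    exact mul_le_of_le_one_left (by positivity) h2
  have h1 : ∀ k, HasSum (fun i => f (k, i)) ((σ k : ℂ) * ⟪u k, (C * B) (u k)⟫_ℂ) := by
    intro k
    have := (e.hasSum_inner_mul_inner (ContinuousLinearMap.adjoint C (u k)) (B (u k))).mul_left
      (σ k : ℂ)
    simpa [f, ContinuousLinearMap.adjoint_inner_left] using this
  have h2 := hf.hasSum.prod_fiberwise h1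
  have h3 : ∑' q, f q = tau u σ (C * B) := h2.tsum_eq.symm
  have hsw : HasSum (fun q : ι × κ => f q.swap) (tau u σ (C * B)) := by
    rw [← h3]
    exact (Equiv.prodComm ι κ).hasSum_iff.mpr hf.hasSum
  refine hsw.prod_fiberwise fun i => ?_
  have := h.hs (ContinuousLinearMap.adjoint B (e i)) (C (e i))
  simp only [ContinuousLinearMap.adjoint_inner_left] at this
  have e2 : (fun k => f (Prod.swap (i, k))) =
      fun k => (σ k : ℂ) * (⟪e i, B (u k)⟫_ℂ * ⟪u k, C (e i)⟫_ℂ) := by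
    funext k
    simp only [f, Prod.swap, ContinuousLinearMap.adjoint_inner_left]
    ring
  rw [e2]
  exact this

lemma tau_sm (hs : Summable fun k => ‖u k‖ ^ 2) (hg : ∀ k, |σ k| ≤ 1) (B : H →L[ℂ] H) :
    Summable (fun k => (σ k : ℂ) * ⟪u k, B (u k)⟫_ℂ) ∧ ‖tau u σ B‖ ≤ (∑' k, ‖u k‖ ^ 2) * ‖B‖ := by
  have hb : ∀ k, ‖(σ k : ℂ) * ⟪u k, B (u k)⟫_ℂ‖ ≤ ‖u k‖ ^ 2 * ‖B‖ := by
    intro k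
    rw [norm_mul]
    have h2 : ‖(σ k : ℂ)‖ ≤ 1 := by simpa using hg k
    have h3 := norm_inner_le_norm (𝕜 := ℂ) (u k) (B (u k))
    have h4 := B.le_opNorm (u k)
    calc _ ≤ 1 * (‖u k‖ * (‖B‖ * ‖u k‖)) := by
          gcongr; exact h3.trans (by gcongr)
      _ = _ := by ring
  refine ⟨Summable.of_norm_bounded (hs.mul_right _) hb, ?_⟩
  rw [← tsum_mul_right]
  exact tsum_of_norm_bounded (hs.mul_right _).hasSum hb

lemma tau_add (hs : Summable fun k => ‖u k‖ ^ 2) (hg : ∀ k, |σ k| ≤ 1) (B C : H →L[ℂ] H) :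
    tau u σ (B + C) = tau u σ B + tau u σ C := by
  unfold tau
  rw [← (tau_sm hs hg B).1.tsum_add (tau_sm hs hg C).1]
  simp [inner_add_right, mul_add]

lemma tau_smul (c : ℂ) (B : H →L[ℂ] H) :
    tau u σ (c • B) = c * tau u σ B := by
  unfold tau
  rw [← tsum_mul_left]
  simp only [ContinuousLinearMap.smul_apply, inner_smul_right]
  congr! 2
  ring

lemma tau_cont (hs : Summable fun k => ‖u k‖ ^ 2) (hg : ∀ k, |σ k| ≤ 1) :
    Continuous (tau u σ : (H →L[ℂ] H) → ℂ) := by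
  let L : (H →L[ℂ] H) →ₗ[ℂ] ℂ :=
    { toFun := tau u σ
      map_add' := tau_add hs hg
      map_smul' := fun c B => by simpa using tau_smul c B }
  exact (L.mkContinuous _ (fun B => (tau_sm hs hg B).2)).continuous

lemma Rep.nb (h : Rep V u σ) : NB e V (∑' k, ‖u k‖ ^ 2) := by
  intro C D hC hD s
  have h1 : HasSum (fun k => ∑ i ∈ s, (σ k : ℂ) * (⟪e i, C (u k)⟫_ℂ *
      ⟪ContinuousLinearMap.adjoint D (u k), e i⟫_ℂ)) (∑ i ∈ s, ⟪e i, C (V (D (e i)))⟫_ℂ) := by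
    refine hasSum_sum fun i _ => ?_
    have := h.hs (ContinuousLinearMap.adjoint C (e i)) (D (e i))
    simpa [ContinuousLinearMap.adjoint_inner_left] using this
  rw [← h1.tsum_eq]
  refine tsum_of_norm_bounded h.sm.hasSum fun k => ?_
  have h2 : ‖(σ k : ℂ)‖ ≤ 1 := by simpa using h.sg k
  refine (norm_sum_le _ _).trans ?_
  calc _ ≤ ∑ i ∈ s, ‖⟪ContinuousLinearMap.adjoint D (u k), e i⟫_ℂ‖ * ‖⟪e i, C (u k)⟫_ℂ‖ := by
        refine Finset.sum_le_sum fun i _ => ?_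
        rw [norm_mul, norm_mul]
        calc _ ≤ 1 * (‖⟪e i, C (u k)⟫_ℂ‖ * ‖⟪ContinuousLinearMap.adjoint D (u k), e i⟫_ℂ‖) := by
              gcongr
          _ = _ := by ring
    _ ≤ ‖ContinuousLinearMap.adjoint D (u k)‖ * ‖C (u k)‖ := bessel2 e _ _ s
    _ ≤ (1 * ‖u k‖) * (1 * ‖u k‖) := by
        gcongr
        · refine ((ContinuousLinearMap.adjoint D).le_opNorm _).trans ?_
          gcongr
          simpa using hD
        · exact (C.le_opNorm _).trans (by gcongr)
    _ = _ := by ring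

lemma HasTr.add {T S : H →L[ℂ] H} {t s : ℂ} (h : HasTr e T t) (h' : HasTr e S s) :
    HasTr e (T + S) (t + s) := by
  have := HasSum.add h h'
  simpa [HasTr, inner_add_right] using this

lemma HasTr.smul {T : H →L[ℂ] H} {t : ℂ} (h : HasTr e T t) (c : ℂ) :
    HasTr e (c • T) (c * t) := by
  have := HasSum.mul_left c h
  simpa [HasTr, inner_smul_right] using this

lemma HasTr.zero : HasTr e (0 : H →L[ℂ] H) 0 := by
  simp [HasTr, hasSum_zero]

lemma HasTr.sum {α : Type*} (t : Finset α) {T : α → H →L[ℂ] H} {M : α → ℂ}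
    (h : ∀ a ∈ t, HasTr e (T a) (M a)) : HasTr e (∑ a ∈ t, T a) (∑ a ∈ t, M a) := by
  classical
  induction t using Finset.induction_on with
  | empty => simpa using HasTr.zero
  | insert a t ha ih =>
    rw [Finset.sum_insert ha, Finset.sum_insert ha]
    exact (h a (by simp)).add (ih fun b hb => h b (by simp [hb]))

/-- Series of trace class operators. -/
lemma HasTr.tsum {T : ℕ → H →L[ℂ] H} {S : H →L[ℂ] H} {t : ℕ → ℂ} {M : ℕ → ℝ}
    (hT : ∀ n, HasTr e (T n) (t n)) (hN : ∀ n, NB e (T n) (M n)) (hM : Summable M)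
    (hS : HasSum T S) : HasTr e S (∑' n, t n) ∧ NB e S (∑' n, M n) := by
  have hw : ∀ (C D : H →L[ℂ] H) (s : Finset ι), HasSum (fun n => ∑ i ∈ s, ⟪e i, C (T n (D (e i)))⟫_ℂ)
      (∑ i ∈ s, ⟪e i, C (S (D (e i)))⟫_ℂ) := by
    intro C D s
    refine hasSum_sum fun i _ => ?_
    let L : (H →L[ℂ] H) →L[ℂ] ℂ :=
      (innerSL ℂ (e i)).comp (C.comp (ContinuousLinearMap.apply ℂ H (D (e i))))
    exact L.hasSum hS
  constructor
  · have h1 := tendsto_tsum_of_dominated_convergence (𝓕 := (atTop : Filter (Finset ι)))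
      (f := fun s n => ∑ i ∈ s, ⟪e i, T n (e i)⟫_ℂ) (g := t) (bound := M) hM
      (fun n => hT n) (Eventually.of_forall fun s n => by
        have := hN n 1 1 ContinuousLinearMap.norm_id_le ContinuousLinearMap.norm_id_le s
        simpa using this)
    refine h1.congr fun s => ?_
    have := (hw 1 1 s).tsum_eq
    simpa using this
  · intro C D hC hD s
    rw [← (hw C D s).tsum_eq]
    exact tsum_of_norm_bounded hM.hasSum fun n => hN n C D hC hD s

end K1

section K2
set_option linter.unusedSectionVars false
set_option linter.unusedSimpArgs false
set_option linter.deprecated false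
open Filter Topology
variable {H : Type*} [NormedAddCommGroup H] [InnerProductSpace ℂ H] [CompleteSpace H]
variable {ι : Type*} {e : HilbertBasis ι ℂ H}
variable {κ : Type*} {V : H →L[ℂ] H} {u : κ → H} {σ : κ → ℝ}

/-- The segment from `A` to `A + V`. -/
noncomputable def seg (A V : H →L[ℂ] H) (s : ℝ) : H →L[ℂ] H := A + (s : ℂ) • V

lemma seg_cont (A V : H →L[ℂ] H) : Continuous (seg A V) := by
  unfold seg; fun_prop

lemma pow_sub_pow_nc (X Y : H →L[ℂ] H) (n : ℕ) :
    X ^ n - Y ^ n = ∑ j ∈ Finset.range n, X ^ j * (X - Y) * Y ^ (n - 1 - j) := by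
  induction n with
  | zero => simp
  | succ n ih =>
    rw [Finset.sum_range_succ]
    have e1 : ∑ j ∈ Finset.range n, X ^ j * (X - Y) * Y ^ (n + 1 - 1 - j)
        = (X ^ n - Y ^ n) * Y := by
      rw [ih, Finset.sum_mul]
      refine Finset.sum_congr rfl fun j hj => ?_
      have : n + 1 - 1 - j = (n - 1 - j) + 1 := by
        have := Finset.mem_range.1 hj; omega
      rw [this, pow_succ]; noncomm_ring
    rw [e1]
    simp only [Nat.add_sub_cancel, Nat.sub_self, pow_zero, mul_one, pow_succ]
    noncomm_ring

lemma Rep.hasTr_pow_diff (h : Rep V u σ) (A : H →L[ℂ] H) (s r : ℝ) (n : ℕ) :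
    HasTr e (seg A V s ^ n - seg A V r ^ n) (((s : ℂ) - r) *
      ∑ j ∈ Finset.range n, tau u σ (seg A V r ^ (n - 1 - j) * seg A V s ^ j)) := by
  rw [pow_sub_pow_nc, Finset.mul_sum]
  refine HasTr.sum _ fun j _ => ?_
  have e1 : seg A V s - seg A V r = ((s : ℂ) - r) • V := by
    unfold seg; rw [sub_smul]; abel
  have := (h.hasTr (e := e) (seg A V s ^ j) (seg A V r ^ (n - 1 - j))).smul ((s : ℂ) - r)
  rw [e1]
  simpa [smul_mul_assoc, mul_smul_comm] using this

lemma Rep.hasTr_pow (h : Rep V u σ) (A : H →L[ℂ] H) (n : ℕ) :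
    HasTr e ((A + V) ^ n - A ^ n)
      (∫ s in (0:ℝ)..1, (n : ℂ) * tau u σ (seg A V s ^ (n - 1))) := by
  have hc : Continuous (tau u σ) := tau_cont h.sm h.sg
  have hsc := seg_cont A V
  let f : ℝ → ℂ := fun s => ((s : ℂ) - (0 : ℝ)) *
      ∑ j ∈ Finset.range n, tau u σ (seg A V 0 ^ (n - 1 - j) * seg A V s ^ j)
  let g : ℝ → ℝ → ℂ := fun r s =>
      ∑ j ∈ Finset.range n, tau u σ (seg A V r ^ (n - 1 - j) * seg A V s ^ j)
  have hfg : ∀ r s, f s - f r = ((s : ℂ) - r) * g r s := by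
    intro r s
    have h1 := h.hasTr_pow_diff (e := e) A s 0 n
    have h2 := (h.hasTr_pow_diff (e := e) A r 0 n).smul (-1)
    have h3 := h.hasTr_pow_diff (e := e) A s r n
    have h4 := h1.add h2
    have e1 : seg A V s ^ n - seg A V 0 ^ n + (-1 : ℂ) • (seg A V r ^ n - seg A V 0 ^ n)
      = seg A V s ^ n - seg A V r ^ n := by
      rw [neg_one_smul]; abel
    rw [e1] at h4
    have := h4.unique h3
    rw [← this]; simp only [f]; ring
  have hgr : ∀ r, g r r = (n : ℂ) * tau u σ (seg A V r ^ (n - 1)) := by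
    intro r
    simp only [g]
    rw [Finset.sum_congr rfl (g := fun _ => tau u σ (seg A V r ^ (n - 1)))]
    · simp
    · intro j hj
      have := Finset.mem_range.1 hj
      rw [← pow_add]; congr 2; omega
  have hd : ∀ r, HasDerivAt f ((n : ℂ) * tau u σ (seg A V r ^ (n - 1))) r := by
    intro r
    rw [← hgr, hasDerivAt_iff_tendsto_slope]
    have hgc : Continuous (g r) := by
      simp only [g]
      refine continuous_finsetSum _ fun j _ => hc.comp ?_
      exact continuous_const.mul (hsc.pow j)
    refine ((hgc.tendsto r).mono_left nhdsWithin_le_nhds).congr' ?_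
    filter_upwards [self_mem_nhdsWithin] with s hs
    have hsr : (s : ℂ) - r ≠ 0 := by
      rw [sub_ne_zero]; exact_mod_cast hs
    rw [slope_def_module, hfg r s, ← Complex.coe_smul]
    push_cast
    rw [smul_eq_mul, inv_mul_cancel_left₀ hsr]
  have hI := intervalIntegral.integral_eq_sub_of_hasDerivAt (f := f) (a := 0) (b := 1)
    (fun r _ => hd r) (Continuous.intervalIntegrable (by
      exact continuous_const.mul (hc.comp (hsc.pow _))) _ _)
  rw [hI, hfg]
  have := h.hasTr_pow_diff (e := e) A 1 0 n
  simpa [seg, g] using this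

lemma Rep.hasTr_poly (h : Rep V u σ) (A : H →L[ℂ] H) (q : ℝ[X]) :
    HasTr e (aeval (A + V) q - aeval A q)
      (∫ s in (0:ℝ)..1, tau u σ (aeval (seg A V s) (derivative q))) := by
  have hc : Continuous (tau u σ) := tau_cont h.sm h.sg
  have hsc := seg_cont A V
  have hci : ∀ q : ℝ[X], Continuous fun s => tau u σ (aeval (seg A V s) q) := by
    intro q
    refine hc.comp ?_
    exact q.continuous_aeval.comp hsc
  induction q using Polynomial.induction_on' with
  | add p q hp hq =>
    have := hp.add hq
    have e1 : (∫ s in (0:ℝ)..1, tau u σ (aeval (seg A V s) (derivative (p + q)))) =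
        (∫ s in (0:ℝ)..1, tau u σ (aeval (seg A V s) (derivative p))) +
        ∫ s in (0:ℝ)..1, tau u σ (aeval (seg A V s) (derivative q)) := by
      rw [← intervalIntegral.integral_add ((hci _).intervalIntegrable _ _)
        ((hci _).intervalIntegrable _ _)]
      simp only [derivative_add, map_add, tau_add h.sm h.sg]
    rw [e1]
    convert this using 1
    simp only [map_add]; abel
  | monomial n c =>
    have := (h.hasTr_pow (e := e) A n).smul (c : ℂ)
    have key : ∀ (X : H →L[ℂ] H) (m : ℕ) (d : ℝ), aeval X (monomial m d) = (d : ℂ) • X ^ m := by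
      intro X m d
      rw [aeval_monomial, ← Algebra.smul_def, Complex.coe_smul]
    have e1 : (∫ s in (0:ℝ)..1, tau u σ (aeval (seg A V s) (derivative (monomial n c)))) =
        (c : ℂ) * ∫ s in (0:ℝ)..1, (n : ℂ) * tau u σ (seg A V s ^ (n - 1)) := by
      rw [← intervalIntegral.integral_const_mul]
      congr 1
      funext s
      rw [derivative_monomial, key, tau_smul]
      push_cast; ring
    rw [e1, key, key, ← smul_sub]
    exact this

lemma absOp_nonneg (T : H →L[ℂ] H) : 0 ≤ absOp T := by
  unfold absOp
  exact cfc_nonneg fun x _ => Real.sqrt_nonneg x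

lemma absOp_inner_nonneg (T : H →L[ℂ] H) (x : H) : 0 ≤ (⟪x, absOp T x⟫_ℂ).re := by
  have := (ContinuousLinearMap.nonneg_iff_isPositive _).1 (absOp_nonneg T)
  simpa using this.re_inner_nonneg_right x

lemma NB.absOp_approx (T : H →L[ℂ] H) {ε : ℝ} (hε : 0 < ε) :
    ∃ C : H →L[ℂ] H, ‖C‖ ≤ 1 ∧ ‖absOp T - C * T‖ ≤ ε := by
  set P : H →L[ℂ] H := ContinuousLinearMap.adjoint T * T with hP
  have hPn : 0 ≤ P := by
    have : P = star T * T := rfl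
    rw [this]; exact star_mul_self_nonneg T
  have hsp : ∀ x ∈ spectrum ℝ P, 0 ≤ x := fun x hx => spectrum_nonneg_of_nonneg hPn hx
  have hsa : IsSelfAdjoint P := IsSelfAdjoint.of_nonneg hPn
  let g : ℝ → ℝ := fun x => (√x + ε)⁻¹
  have hgc : Continuous g := by
    refine Continuous.inv₀ (by fun_prop) fun x => ?_
    have := Real.sqrt_nonneg x
    positivity
  refine ⟨cfc g P * star T, ?_, ?_⟩
  · have h1 : ‖(cfc g P * star T) * star (cfc g P * star T)‖ ≤ 1 := by
      have e1 : (cfc g P * star T) * star (cfc g P * star T) = cfc (fun x => g x * x * g x) P := by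
        rw [cfc_mul (fun x => g x * x) g P (by fun_prop) (by fun_prop),
          cfc_mul g (fun x => x) P (by fun_prop) (by fun_prop), cfc_id' ℝ P]
        have : star (cfc g P) = cfc g P := (cfc_predicate g P : IsSelfAdjoint _)
        rw [star_mul, star_star, this, hP]
        change _ = cfc g P * (star T * T) * cfc g P
        noncomm_ring
      rw [e1]
      refine norm_cfc_le zero_le_one fun x hx => ?_
      have hx0 := hsp x hx
      have hs := Real.sqrt_nonneg x
      have : g x * x * g x = (√x * g x) ^ 2 := by
        nth_rw 2 [← Real.sq_sqrt hx0]; ring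
      rw [this, Real.norm_of_nonneg (by positivity)]
      have h3 : √x * g x ≤ 1 := by
        simp only [g]
        rw [← div_eq_mul_inv, div_le_one (by positivity)]; linarith
      have h4 : 0 ≤ √x * g x := by simp only [g]; positivity
      exact pow_le_one₀ h4 h3
    rw [CStarRing.norm_self_mul_star] at h1
    nlinarith [norm_nonneg (cfc g P * star T)]
  · have e1 : absOp T - cfc g P * star T * T = cfc (fun x => √x - g x * x) P := by
      rw [cfc_sub (fun x => √x) (fun x => g x * x) P (by fun_prop) (by fun_prop),
          cfc_mul g (fun x => x) P (by fun_prop) (by fun_prop), cfc_id' ℝ P, mul_assoc]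
      rfl
    rw [e1]
    refine norm_cfc_le hε.le fun x hx => ?_
    have hx0 := hsp x hx
    have hs := Real.sqrt_nonneg x
    have : √x - g x * x = ε * (√x / (√x + ε)) := by
      simp only [g]
      have : √x + ε ≠ 0 := by positivity
      nth_rw 3 [← Real.sq_sqrt hx0]
      field_simp; ring
    rw [this, Real.norm_of_nonneg (by positivity)]
    have h3 : √x / (√x + ε) ≤ 1 := by
      rw [div_le_one (by positivity)]; linarith
    nlinarith

lemma NB.isTraceClass {T : H →L[ℂ] H} {M : ℝ} (h : NB e T M) : IsTraceClass e T := by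
  refine summable_of_sum_le (c := M) (fun i => absOp_inner_nonneg T (e i)) fun s => ?_
  refine le_of_forall_pos_le_add fun δ hδ => ?_
  obtain ⟨C, hC, hCT⟩ := NB.absOp_approx T (ε := δ / (s.card + 1)) (by positivity)
  have h1 := h C 1 hC ContinuousLinearMap.norm_id_le s
  have h2 : ∀ i ∈ s, (⟪e i, absOp T (e i)⟫_ℂ).re ≤
      (⟪e i, C (T ((1 : H →L[ℂ] H) (e i)))⟫_ℂ).re + δ / (s.card + 1) := by
    intro i _
    have e1 : ⟪e i, absOp T (e i)⟫_ℂ = ⟪e i, C (T ((1 : H →L[ℂ] H) (e i)))⟫_ℂ +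
        ⟪e i, (absOp T - C * T) (e i)⟫_ℂ := by
      rw [← inner_add_right]; simp
    rw [e1, Complex.add_re]
    gcongr
    refine (Complex.re_le_norm _).trans ((norm_inner_le_norm _ _).trans ?_)
    have h3 := (absOp T - C * T).le_opNorm (e i)
    rw [e.orthonormal.norm_eq_one i] at h3 ⊢
    linarith
  refine (Finset.sum_le_sum h2).trans ?_
  rw [Finset.sum_add_distrib, ← Complex.re_sum]
  gcongr
  · exact (Complex.re_le_norm _).trans h1
  · simp only [Finset.sum_const, nsmul_eq_mul]
    rw [mul_div_assoc', div_le_iff₀ (by positivity)]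
    nlinarith

end K2

section K3
set_option linter.unusedSectionVars false
set_option linter.unusedSimpArgs false
set_option linter.deprecated false
open Filter Topology
variable {H : Type*} [NormedAddCommGroup H] [InnerProductSpace ℂ H] [CompleteSpace H]
variable {ι : Type*} {e : HilbertBasis ι ℂ H}

lemma absOp_eq_abs {V : H →L[ℂ] H} (hV : IsSelfAdjoint V) :
    absOp V = cfc (fun x : ℝ => |x|) V := by
  unfold absOp
  have e1 : ContinuousLinearMap.adjoint V * V = cfc (fun x : ℝ => x * x) V := by
    rw [cfc_mul (fun x : ℝ => x) (fun x => x) V (by fun_prop) (by fun_prop), cfc_id' ℝ V]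
    have : ContinuousLinearMap.adjoint V = V := hV
    rw [this]
  rw [e1, ← cfc_comp' Real.sqrt (fun x : ℝ => x * x) V (by fun_prop) (by fun_prop)]
  simp [Real.sqrt_mul_self_eq_abs]

/-- The decomposition of a selfadjoint trace class operator into a series of rank one operators. -/
lemma exists_rep {V : H →L[ℂ] H} (hV : IsSelfAdjoint V) (ht : IsTraceClass e V) :
    ∃ (u : ι ⊕ ι → H) (σ : ι ⊕ ι → ℝ), Rep V u σ ∧ (∀ k, σ k = 1 ∨ σ k = -1) ∧
      ∑' k, ‖u k‖ ^ 2 = traceNorm e V ∧ (V.IsPositive → ∀ k, σ k = 1 ∨ u k = 0) ∧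
      ((-V).IsPositive → ∀ k, σ k = -1 ∨ u k = 0) := by
  let gp : ℝ → ℝ := fun x => √(max x 0)
  let gm : ℝ → ℝ := fun x => √(max (-x) 0)
  have hgp : Continuous gp := by fun_prop
  have hgm : Continuous gm := by fun_prop
  let Bp := cfc gp V
  let Bm := cfc gm V
  have hBp : IsSelfAdjoint Bp := cfc_predicate gp V
  have hBm : IsSelfAdjoint Bm := cfc_predicate gm V
  have eV : V = Bp * Bp - Bm * Bm := by
    rw [← cfc_mul gp gp V (by fun_prop) (by fun_prop), ← cfc_mul gm gm V (by fun_prop) (by fun_prop),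
      ← cfc_sub _ _ V (by fun_prop) (by fun_prop)]
    conv_lhs => rw [← cfc_id' ℝ V]
    refine cfc_congr fun x _ => ?_
    simp only [gp, gm]
    rw [Real.mul_self_sqrt (le_max_right _ _), Real.mul_self_sqrt (le_max_right _ _)]
    rcases le_total x 0 with h | h
    · rw [max_eq_right h, max_eq_left (by linarith)]; ring
    · rw [max_eq_left h, max_eq_right (by linarith)]; ring
  have eA : absOp V = Bp * Bp + Bm * Bm := by
    rw [absOp_eq_abs hV]
    rw [← cfc_mul gp gp V (by fun_prop) (by fun_prop), ← cfc_mul gm gm V (by fun_prop) (by fun_prop),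
      ← cfc_add _ _ _ (by fun_prop) (by fun_prop)]
    refine cfc_congr fun x _ => ?_
    simp only [gp, gm]
    rw [Real.mul_self_sqrt (le_max_right _ _), Real.mul_self_sqrt (le_max_right _ _)]
    rcases le_total x 0 with h | h
    · rw [max_eq_right h, max_eq_left (by linarith), abs_of_nonpos h]; ring
    · rw [max_eq_left h, max_eq_right (by linarith), abs_of_nonneg h]; ring
  have sp : ∀ x y, ⟪Bp x, y⟫_ℂ = ⟪x, Bp y⟫_ℂ := fun x y => by
    rw [← ContinuousLinearMap.adjoint_inner_left]
    have : ContinuousLinearMap.adjoint Bp = Bp := hBp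
    rw [this]
  have sm : ∀ x y, ⟪Bm x, y⟫_ℂ = ⟪x, Bm y⟫_ℂ := fun x y => by
    rw [← ContinuousLinearMap.adjoint_inner_left]
    have : ContinuousLinearMap.adjoint Bm = Bm := hBm
    rw [this]
  have hn : ∀ i, (⟪e i, absOp V (e i)⟫_ℂ).re = ‖Bp (e i)‖ ^ 2 + ‖Bm (e i)‖ ^ 2 := by
    intro i
    rw [eA]
    have : ⟪e i, (Bp * Bp + Bm * Bm) (e i)⟫_ℂ = ⟪Bp (e i), Bp (e i)⟫_ℂ + ⟪Bm (e i), Bm (e i)⟫_ℂ := by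
      rw [sp, sm, ← inner_add_right]; rfl
    rw [this, inner_self_eq_norm_sq_to_K, inner_self_eq_norm_sq_to_K]
    norm_cast
  have ht' : Summable fun i => ‖Bp (e i)‖ ^ 2 + ‖Bm (e i)‖ ^ 2 := by
    have := ht
    unfold IsTraceClass at this
    simpa only [hn] using this
  have hsp : Summable fun i => ‖Bp (e i)‖ ^ 2 :=
    Summable.of_nonneg_of_le (fun i => by positivity) (fun i => by nlinarith [sq_nonneg ‖Bm (e i)‖]) ht'
  have hsm : Summable fun i => ‖Bm (e i)‖ ^ 2 :=
    Summable.of_nonneg_of_le (fun i => by positivity) (fun i => by nlinarith [sq_nonneg ‖Bp (e i)‖]) ht'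
  refine ⟨Sum.elim (fun i => Bp (e i)) (fun i => Bm (e i)), Sum.elim (fun _ => 1) (fun _ => -1),
    ⟨?_, ?_, ?_⟩, ?_, ?_, ?_, ?_⟩
  · exact (HasSum.sum (f := fun k => ‖Sum.elim (fun i => Bp (e i)) (fun i => Bm (e i)) k‖ ^ 2)
      hsp.hasSum hsm.hasSum).summable
  · rintro (k | k) <;> simp
  · intro x y
    have h1 := e.hasSum_inner_mul_inner (Bp x) (Bp y)
    have h2 := (e.hasSum_inner_mul_inner (Bm x) (Bm y)).neg
    have e1 : ⟪x, V y⟫_ℂ = ⟪Bp x, Bp y⟫_ℂ + -⟪Bm x, Bm y⟫_ℂ := by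
      rw [sp, sm, ← sub_eq_add_neg, ← inner_sub_right]
      conv_lhs => rw [eV]
      rfl
    rw [e1]
    refine HasSum.sum ?_ ?_
    · refine h1.congr_fun fun i => ?_
      simp [sp]
    · refine h2.congr_fun fun i => ?_
      simp [sm]
  · rintro (k | k) <;> simp
  · unfold traceNorm
    simp only [hn]
    rw [hsp.tsum_add hsm]
    exact (HasSum.sum (f := fun k => ‖Sum.elim (fun i => Bp (e i)) (fun i => Bm (e i)) k‖ ^ 2)
      hsp.hasSum hsm.hasSum).tsum_eq
  · intro hp
    have : Bm = 0 := by
      have h0 : 0 ≤ V := (ContinuousLinearMap.nonneg_iff_isPositive _).2 hp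
      have : Bm = cfc (fun _ : ℝ => (0:ℝ)) V := by
        refine cfc_congr fun x hx => ?_
        have := spectrum_nonneg_of_nonneg h0 hx
        simp [gm, this]
      rw [this]; simp
    rintro (k | k)
    · simp
    · right; simp [this]
  · intro hp
    have : Bp = 0 := by
      have h0 : 0 ≤ -V := (ContinuousLinearMap.nonneg_iff_isPositive _).2 hp
      have : Bp = cfc (fun _ : ℝ => (0:ℝ)) V := by
        refine cfc_congr fun x hx => ?_
        have : -x ∈ spectrum ℝ (-V) := by
          rw [← spectrum.neg_eq]; simpa using hx
        have := spectrum_nonneg_of_nonneg h0 this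
        simp only [gp]
        rw [max_eq_right (by linarith)]; simp
      rw [this]; simp
    rintro (k | k)
    · right; simp [this]
    · simp

lemma basis_countable [TopologicalSpace.SeparableSpace H] (e : HilbertBasis ι ℂ H) :
    Countable ι := by
  have h : ∀ i j, i ≠ j → 1 ≤ dist (e i) (e j) := by
    intro i j hij
    rw [dist_eq_norm]
    have h2 : ⟪e i, e j⟫_ℂ = 0 := e.orthonormal.2 hij
    have h3 := norm_sub_sq (𝕜 := ℂ) (e i) (e j)
    rw [h2, e.orthonormal.norm_eq_one, e.orthonormal.norm_eq_one] at h3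
    norm_num at h3
    nlinarith [norm_nonneg (e i - e j)]
  have hd : Pairwise (Function.onFun Disjoint fun i => Metric.ball (e i) (1 / 2)) := by
    intro i j hij
    refine Metric.ball_disjoint_ball ?_
    have := h i j hij
    linarith
  exact Pairwise.countable_of_isOpen_disjoint hd (fun i => Metric.isOpen_ball) fun i =>
    Metric.nonempty_ball.2 (by norm_num)

/-- Sequence version of `exists_rep`. -/
lemma exists_rep_seq [TopologicalSpace.SeparableSpace H]
    {V : H →L[ℂ] H} (hV : IsSelfAdjoint V) (ht : IsTraceClass e V) :
    ∃ (u : ℕ → H) (σ : ℕ → ℝ), Rep V u σ ∧ (∀ k, σ k = 1 ∨ σ k = -1) ∧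
      ∑' k, ‖u k‖ ^ 2 = traceNorm e V ∧ (V.IsPositive → ∀ k, σ k = 1 ∨ u k = 0) ∧
      ((-V).IsPositive → ∀ k, σ k = -1 ∨ u k = 0) := by
  obtain ⟨u, σ, h, h1, h2, h3, h4⟩ := exists_rep hV ht
  have := basis_countable e
  obtain ⟨f, hf⟩ := exists_injective_nat (ι ⊕ ι)
  let u' := Function.extend f u 0
  let σ' := Function.extend f σ 1
  have hu : ∀ k, u' (f k) = u k := fun k => hf.extend_apply _ _ _
  have hσ : ∀ k, σ' (f k) = σ k := fun k => hf.extend_apply _ _ _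
  have hu0 : ∀ n, n ∉ Set.range f → u' n = 0 := fun n hn => by
    simp only [u']; rw [Function.extend_apply' _ _ _ (by simpa using hn)]; rfl
  have hσ0 : ∀ n, n ∉ Set.range f → σ' n = 1 := fun n hn => by
    simp only [σ']; rw [Function.extend_apply' _ _ _ (by simpa using hn)]; rfl
  have hs : HasSum (fun n => ‖u' n‖ ^ 2) (∑' k, ‖u k‖ ^ 2) := by
    rw [← hf.hasSum_iff (fun n hn => by simp [hu0 n hn])]
    simpa [Function.comp_def, hu] using h.sm.hasSum
  refine ⟨u', σ', ⟨hs.summable, ?_, ?_⟩, ?_, hs.tsum_eq.trans h2, ?_, ?_⟩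
  · intro n
    by_cases hn : n ∈ Set.range f
    · obtain ⟨k, rfl⟩ := hn; rw [hσ]; exact h.sg k
    · rw [hσ0 n hn]; simp
  · intro x y
    rw [← hf.hasSum_iff (fun n hn => by simp [hu0 n hn])]
    simpa [Function.comp_def, hu, hσ] using h.hs x y
  · intro n
    by_cases hn : n ∈ Set.range f
    · obtain ⟨k, rfl⟩ := hn; rw [hσ]; exact h1 k
    · left; exact hσ0 n hn
  · intro hp n
    by_cases hn : n ∈ Set.range f
    · obtain ⟨k, rfl⟩ := hn; rw [hσ, hu]; exact h3 hp k
    · right; exact hu0 n hn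
  · intro hp n
    by_cases hn : n ∈ Set.range f
    · obtain ⟨k, rfl⟩ := hn; rw [hσ, hu]; exact h4 hp k
    · right; exact hu0 n hn

end K3

section K4
set_option linter.unusedSectionVars false
set_option linter.unusedSimpArgs false
set_option linter.deprecated false
open Filter Topology
variable {H : Type*} [NormedAddCommGroup H] [InnerProductSpace ℂ H] [CompleteSpace H]
variable {ι : Type*} {e : HilbertBasis ι ℂ H}

/-- The rank one operator `x ↦ ⟪u,x⟫ u`. -/
noncomputable def rk (u : H) : H →L[ℂ] H := (innerSL ℂ u).smulRight u

lemma rk_apply (u x : H) : rk u x = ⟪u, x⟫_ℂ • u := rfl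

lemma rk_sa (u : H) : IsSelfAdjoint (rk u) := by
  rw [ContinuousLinearMap.isSelfAdjoint_iff_isSymmetric]
  intro x y
  simp [rk_apply, inner_smul_left, inner_smul_right]
  ring

lemma rk_norm (u : H) : ‖rk u‖ = ‖u‖ ^ 2 := by
  unfold rk
  rw [ContinuousLinearMap.norm_smulRight_apply, innerSL_apply_norm, sq]

lemma seg_sa {A V : H →L[ℂ] H} (hA : IsSelfAdjoint A) (hV : IsSelfAdjoint V) (s : ℝ) :
    IsSelfAdjoint (seg A V s) := by
  unfold seg
  refine hA.add (IsSelfAdjoint.smul ?_ hV)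
  simp [IsSelfAdjoint]

/-- Poisson kernel. -/
noncomputable def pk (t ε x : ℝ) : ℝ := ε / ((x - t) ^ 2 + ε ^ 2)

lemma pk_cont (t : ℝ) {ε : ℝ} (hε : 0 < ε) : Continuous (pk t ε) := by
  unfold pk
  refine continuous_const.div (by fun_prop) fun x => by positivity

lemma pk_nonneg (t x : ℝ) {ε : ℝ} (hε : 0 < ε) : 0 ≤ pk t ε x := by unfold pk; positivity

lemma pk_op {B : H →L[ℂ] H} (hB : IsSelfAdjoint B) (t : ℝ) {ε : ℝ} (hε : 0 < ε) :
    cfc (pk t ε) B * ((B - (t : ℂ) • 1) * (B - (t : ℂ) • 1) + ((ε : ℂ) ^ 2) • 1) = (ε : ℂ) • 1 := by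
  have hc := pk_cont t hε
  have e1 : (B - (t : ℂ) • 1) = cfc (fun x : ℝ => x - t) B := by
    rw [cfc_sub (fun x : ℝ => x) (fun _ => t) B (by fun_prop) (by fun_prop), cfc_id' ℝ B,
      cfc_const t B, Algebra.algebraMap_eq_smul_one]
    congr 1
  have e2 : ((ε : ℂ) ^ 2) • (1 : H →L[ℂ] H) = cfc (fun _ : ℝ => ε ^ 2) B := by
    rw [cfc_const (ε ^ 2) B, Algebra.algebraMap_eq_smul_one]
    rw [← Complex.ofReal_pow]; rfl
  rw [e1, e2, ← cfc_mul _ _ B (by fun_prop) (by fun_prop), ← cfc_add B _ _ (by fun_prop) (by fun_prop),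
    ← cfc_mul _ _ B (by fun_prop) (by fun_prop)]
  have e3 : (fun x : ℝ => pk t ε x * ((x - t) * (x - t) + ε ^ 2)) = fun _ => ε := by
    funext x
    unfold pk
    have : (x - t) ^ 2 + ε ^ 2 ≠ 0 := by positivity
    field_simp
  rw [e3, cfc_const ε B, Algebra.algebraMap_eq_smul_one]
  rfl

lemma pk_comm {B : H →L[ℂ] H} (t ε : ℝ) : Commute (cfc (pk t ε) B) B := by
  by_cases hB : IsSelfAdjoint B
  · nth_rewrite 2 [← cfc_id' ℝ B]
    exact cfc_commute_cfc _ _ _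
  · rw [cfc_apply_of_not_predicate _ hB]; exact Commute.zero_left _

lemma fact_op (B : H →L[ℂ] H) (t ε : ℝ) :
    (B - ((t : ℂ) - ε * Complex.I) • 1) * (B - ((t : ℂ) + ε * Complex.I) • 1) =
    (B - (t : ℂ) • 1) * (B - (t : ℂ) • 1) + ((ε : ℂ) ^ 2) • 1 := by
  have gen : ∀ c d : ℂ, (B - c • (1 : H →L[ℂ] H)) * (B - d • 1) = B * B - (c + d) • B + (c * d) • 1 := by
    intro c d
    ext x
    simp
    module
  rw [gen, gen]
  have h1 : ((t : ℂ) - ε * Complex.I) * ((t : ℂ) + ε * Complex.I) = (t : ℂ) * t + (ε : ℂ) ^ 2 := by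
    linear_combination -(ε : ℂ) ^ 2 * Complex.I_sq
  rw [h1, add_smul _ _ (1 : H →L[ℂ] H), ← add_assoc]
  congr 4
  ring

lemma res_quad {B : H →L[ℂ] H} (hB : IsSelfAdjoint B) (t : ℝ) {ε : ℝ} (hε : 0 < ε) (v w : H)
    (hw : B w - ((t : ℂ) + ε * Complex.I) • w = v) :
    (⟪v, cfc (pk t ε) B v⟫_ℂ).re = ε * ‖w‖ ^ 2 := by
  have hop := pk_op hB t hε
  rw [← fact_op] at hop
  set Q := cfc (pk t ε) B with hQ
  have hcm : Commute Q B := pk_comm t ε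
  have hv : v = (B - ((t : ℂ) + ε * Complex.I) • 1) w := by rw [← hw]; simp
  have hcm2 : Q * (B - ((t : ℂ) - ε * Complex.I) • 1) = (B - ((t : ℂ) - ε * Complex.I) • 1) * Q := by
    rw [mul_sub, sub_mul, hcm.eq]; simp
  rw [← mul_assoc, hcm2, mul_assoc] at hop
  have hadj : ⟪v, Q v⟫_ℂ = ⟪w, ((B - ((t : ℂ) - ε * Complex.I) • 1) * (Q *
      (B - ((t : ℂ) + ε * Complex.I) • 1))) w⟫_ℂ := by
    have hs := (ContinuousLinearMap.isSelfAdjoint_iff_isSymmetric).1 hB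
    have : ∀ x y : H, ⟪B x, y⟫_ℂ = ⟪x, B y⟫_ℂ := hs
    rw [hv]
    simp only [ContinuousLinearMap.mul_apply, ContinuousLinearMap.sub_apply,
      ContinuousLinearMap.smul_apply, ContinuousLinearMap.one_apply]
    rw [inner_sub_left, inner_sub_right, this, inner_smul_left, inner_smul_right]
    congr 2
    simp [Complex.conj_I]; ring
  rw [hadj, hop]
  simp [inner_smul_right, inner_self_eq_norm_sq_to_K]
  left
  norm_cast

lemma res_exists {B : H →L[ℂ] H} (hB : IsSelfAdjoint B) (t : ℝ) {ε : ℝ} (hε : 0 < ε) (v : H) :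
    ∃ w, B w - ((t : ℂ) + ε * Complex.I) • w = v := by
  have hop := pk_op hB t hε
  rw [← fact_op] at hop
  set Q := cfc (pk t ε) B with hQ
  have hcm : Commute Q B := pk_comm t ε
  set R := (B - ((t : ℂ) - ε * Complex.I) • (1 : H →L[ℂ] H)) with hR
  set S := (B - ((t : ℂ) + ε * Complex.I) • (1 : H →L[ℂ] H)) with hS
  have c1 : Commute Q R := hcm.sub_right ((Commute.one_right Q).smul_right _)
  have c2 : Commute Q S := hcm.sub_right ((Commute.one_right Q).smul_right _)
  have c3 : Commute R S := by
    refine Commute.sub_left ?_ ((Commute.one_left S).smul_left _)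
    exact (Commute.refl B).sub_right ((Commute.one_right B).smul_right _)
  have e1 : S * (R * Q) = (ε : ℂ) • 1 := by
    rw [← hop, c3.eq, ← mul_assoc, ← (c2.mul_right c1).eq]
  refine ⟨((ε : ℂ)⁻¹) • ((R * Q) v), ?_⟩
  have e2 : ∀ w, B w - ((t : ℂ) + ε * Complex.I) • w = S w := fun w => by simp [hS]
  rw [e2, map_smul, ← ContinuousLinearMap.mul_apply, e1]
  have : (ε : ℂ) ≠ 0 := by exact_mod_cast hε.ne'
  rw [ContinuousLinearMap.smul_apply, smul_smul, inv_mul_cancel₀ this, one_smul]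
  rfl

lemma poisson_int (a b : ℝ) (hb : 0 < b) :
    ∫ s in (0:ℝ)..1, b / ((1 + s * a) ^ 2 + (s * b) ^ 2) ≤ Real.pi := by
  have hpos : ∀ s : ℝ, 0 < (1 + s * a) ^ 2 + (s * b) ^ 2 := by
    intro s
    rcases eq_or_ne s 0 with rfl | hs
    · simp
    · positivity
  have hd : ∀ s ∈ Set.uIcc (0:ℝ) 1, HasDerivAt
      (fun s => Real.arctan ((s * (a ^ 2 + b ^ 2) + a) / b))
      (b / ((1 + s * a) ^ 2 + (s * b) ^ 2)) s := by
    intro s _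
    have h1 : HasDerivAt (fun s : ℝ => (s * (a ^ 2 + b ^ 2) + a) / b) ((a ^ 2 + b ^ 2) / b) s := by
      simpa using (((hasDerivAt_id s).mul_const (a ^ 2 + b ^ 2)).add_const a).div_const b
    have := h1.arctan
    convert this using 1
    have h2 := hpos s
    have h3 : 0 < 1 + ((s * (a ^ 2 + b ^ 2) + a) / b) ^ 2 := by positivity
    rw [div_mul_div_comm, div_eq_div_iff h2.ne' (by positivity)]
    field_simp
    ring
  have hcont : Continuous fun s : ℝ => b / ((1 + s * a) ^ 2 + (s * b) ^ 2) :=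
    continuous_const.div (by fun_prop) fun s => (hpos s).ne'
  rw [intervalIntegral.integral_eq_sub_of_hasDerivAt hd (hcont.intervalIntegrable _ _)]
  have := Real.arctan_lt_pi_div_two ((1 * (a ^ 2 + b ^ 2) + a) / b)
  have := Real.neg_pi_div_two_lt_arctan ((0 * (a ^ 2 + b ^ 2) + a) / b)
  linarith

/-- The averaged spectral functional. -/
noncomputable def Lam (A : H →L[ℂ] H) (u : H) (f : ℝ → ℝ) : ℝ :=
  ∫ s in (0:ℝ)..1, (⟪u, cfc f (seg A (rk u) s) u⟫_ℂ).re

lemma Lam_cont {A : H →L[ℂ] H} (hA : IsSelfAdjoint A) (u : H) {f : ℝ → ℝ} (hf : Continuous f) :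
    Continuous fun s : ℝ => (⟪u, cfc f (seg A (rk u) s) u⟫_ℂ).re := by
  have : Continuous fun s : ℝ => cfc f (seg A (rk u) s) := by
    exact Continuous.cfc_of_mem_nhdsSet (s := Set.univ) f Filter.univ_mem (seg_cont A (rk u))
      (fun s => seg_sa hA (rk_sa u) s) hf.continuousOn
  fun_prop

lemma Lam_pk {A : H →L[ℂ] H} (hA : IsSelfAdjoint A) (u : H) (t : ℝ) {ε : ℝ} (hε : 0 < ε) :
    Lam A u (pk t ε) ≤ Real.pi := by
  unfold Lam
  rcases eq_or_ne u 0 with rfl | hu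
  · simp [Real.pi_pos.le]
  obtain ⟨w, hw⟩ := res_exists hA t hε u
  set F : ℂ := ⟪u, w⟫_ℂ with hF
  have hs : ∀ x y : H, ⟪A x, y⟫_ℂ = ⟪x, A y⟫_ℂ :=
    (ContinuousLinearMap.isSelfAdjoint_iff_isSymmetric).1 hA
  have hw0 : w ≠ 0 := by rintro rfl; simp at hw; exact hu hw.symm
  have hFi : F.im = ε * ‖w‖ ^ 2 := by
    rw [hF]; nth_rewrite 1 [← hw]
    rw [inner_sub_left, inner_smul_left]
    have h1 : (⟪A w, w⟫_ℂ).im = 0 := by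
      have h2 : (starRingEnd ℂ) ⟪A w, w⟫_ℂ = ⟪A w, w⟫_ℂ := by
        rw [inner_conj_symm, hs]
      exact Complex.conj_eq_iff_im.1 h2
    rw [Complex.sub_im, h1, inner_self_eq_norm_sq_to_K]
    simp
    norm_cast
    simp
  have hb : 0 < F.im := by rw [hFi]; positivity
  have key : ∀ s : ℝ, (⟪u, cfc (pk t ε) (seg A (rk u) s) u⟫_ℂ).re =
      F.im / ((1 + s * F.re) ^ 2 + (s * F.im) ^ 2) := by
    intro s
    have hne : Complex.normSq (1 + s * F) = (1 + s * F.re) ^ 2 + (s * F.im) ^ 2 := by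
      rw [Complex.normSq_apply]; simp; ring
    have hpos : 0 < (1 + s * F.re) ^ 2 + (s * F.im) ^ 2 := by
      rcases eq_or_ne s 0 with rfl | hs
      · simp
      · positivity
    have h0 : (1 + s * F) ≠ 0 := by
      rw [← Complex.normSq_pos, hne]; exact hpos
    have := res_quad (seg_sa hA (rk_sa u) s) t hε u ((1 + s * F)⁻¹ • w) ?_
    · rw [this, norm_smul, mul_pow, norm_inv, inv_pow, ← Complex.normSq_eq_norm_sq, hne, hFi]
      field_simp
    · unfold seg
      simp only [ContinuousLinearMap.add_apply, ContinuousLinearMap.smul_apply, map_smul, rk_apply]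
      rw [← hF]
      have e1 : A w = u + ((t : ℂ) + ε * Complex.I) • w := by rw [← hw]; abel
      rw [e1]
      have e2 : (1 + s * F)⁻¹ • (1 + s * F) • u = u := by rw [smul_smul, inv_mul_cancel₀ h0, one_smul]
      nth_rewrite 3 [← e2]
      module
  simp_rw [key]
  exact poisson_int F.re F.im hb

end K4

section K5
set_option linter.unusedSectionVars false
set_option linter.unusedSimpArgs false
set_option linter.deprecated false
open Filter Topology
open CompactlySupported
variable {H : Type*} [NormedAddCommGroup H] [InnerProductSpace ℂ H] [CompleteSpace H]
variable {ι : Type*} {e : HilbertBasis ι ℂ H}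

lemma spec_abs_le {B : H →L[ℂ] H} {M : ℝ} (hM : ‖B‖ ≤ M) {x : ℝ} (hx : x ∈ spectrum ℝ B) :
    |x| ≤ M := by
  have h := spectrum.norm_le_norm_mul_of_mem hx
  have h1 : ‖(1 : H →L[ℂ] H)‖ ≤ 1 := ContinuousLinearMap.norm_id_le
  calc |x| ≤ ‖B‖ * ‖(1 : H →L[ℂ] H)‖ := h
    _ ≤ ‖B‖ * 1 := by gcongr
    _ ≤ M := by rw [mul_one]; exact hM

section

lemma Lam_add {A : H →L[ℂ] H} (hA : IsSelfAdjoint A) (u : H) {f g : ℝ → ℝ} (hf : Continuous f) (hg : Continuous g) :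
    Lam A u (fun x => f x + g x) = Lam A u f + Lam A u g := by
  unfold Lam
  rw [← intervalIntegral.integral_add ((Lam_cont hA u hf).intervalIntegrable _ _)
    ((Lam_cont hA u hg).intervalIntegrable _ _)]
  congr 1; funext s
  rw [cfc_add _ f g hf.continuousOn hg.continuousOn]
  simp [inner_add_right]

lemma Lam_smul {A : H →L[ℂ] H} (hA : IsSelfAdjoint A) (u : H) (c : ℝ) {f : ℝ → ℝ} (hf : Continuous f) :
    Lam A u (fun x => c * f x) = c * Lam A u f := by
  unfold Lam
  rw [← intervalIntegral.integral_const_mul]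
  congr 1; funext s
  rw [cfc_const_mul c f _ hf.continuousOn]
  have : (c • cfc f (seg A (rk u) s)) u = (c : ℂ) • (cfc f (seg A (rk u) s)) u := rfl
  rw [this, inner_smul_right]
  simp

lemma Lam_nonneg {A : H →L[ℂ] H} (hA : IsSelfAdjoint A) (u : H) {f : ℝ → ℝ} (hf : ∀ x, 0 ≤ f x) : 0 ≤ Lam A u f := by
  unfold Lam
  refine intervalIntegral.integral_nonneg (by norm_num) fun s _ => ?_
  have h : 0 ≤ cfc f (seg A (rk u) s) := cfc_nonneg fun x _ => hf x
  have := (ContinuousLinearMap.nonneg_iff_isPositive _).1 h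
  simpa using this.re_inner_nonneg_right u

lemma Lam_mono {A : H →L[ℂ] H} (hA : IsSelfAdjoint A) (u : H) {f g : ℝ → ℝ} (hf : Continuous f) (hg : Continuous g) (h : ∀ x, f x ≤ g x) :
    Lam A u f ≤ Lam A u g := by
  have h1 := Lam_nonneg hA u (f := fun x => g x + (-1) * f x) (fun x => by linarith [h x])
  rw [Lam_add hA u hg (by fun_prop), Lam_smul hA u _ hf] at h1
  linarith

lemma Lam_one {A : H →L[ℂ] H} (hA : IsSelfAdjoint A) (u : H) : Lam A u (fun _ => 1) = ‖u‖ ^ 2 := by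
  unfold Lam
  have : ∀ s : ℝ, (⟪u, cfc (fun _ : ℝ => (1 : ℝ)) (seg A (rk u) s) u⟫_ℂ).re = ‖u‖ ^ 2 := by
    intro s
    rw [cfc_const_one ℝ _ (seg_sa hA (rk_sa u) s)]
    simp [inner_self_eq_norm_sq_to_K]
    norm_cast
  simp [this]

lemma Lam_congr {A : H →L[ℂ] H} (u : H) {M : ℝ} (hM : ∀ s ∈ Set.Icc (0:ℝ) 1, ‖seg A (rk u) s‖ ≤ M) {f g : ℝ → ℝ}
    (h : ∀ x, |x| ≤ M → f x = g x) : Lam A u f = Lam A u g := by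
  unfold Lam
  refine intervalIntegral.integral_congr fun s hs => ?_
  rw [Set.uIcc_of_le (by norm_num)] at hs
  show (⟪u, cfc f (seg A (rk u) s) u⟫_ℂ).re = (⟪u, cfc g (seg A (rk u) s) u⟫_ℂ).re
  rw [cfc_congr (fun x hx => h x (spec_abs_le (hM s hs) hx))]

/-- The averaged functional as a positive functional. -/
noncomputable def LamP (A : H →L[ℂ] H) (hA : IsSelfAdjoint A) (u : H) : C_c(ℝ, ℝ) →ₚ[ℝ] ℝ :=
  PositiveLinearMap.mk₀
    { toFun := fun f => Lam A u f
      map_add' := fun f g => Lam_add hA u f.continuous g.continuous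
      map_smul' := fun c f => Lam_smul hA u c f.continuous }
    (fun f hf => Lam_nonneg hA u hf)

lemma LamP_apply {A : H →L[ℂ] H} (hA : IsSelfAdjoint A) (u : H) (f : C_c(ℝ, ℝ)) : LamP A hA u f = Lam A u f := rfl

end

/-- cutoff -/
noncomputable def cut (n : ℕ) (x : ℝ) : ℝ := max 0 (min 1 (n + 1 - |x|))

lemma cut_cont (n : ℕ) : Continuous (cut n) := by unfold cut; fun_prop
lemma cut_nonneg (n : ℕ) (x : ℝ) : 0 ≤ cut n x := le_max_left _ _
lemma cut_le (n : ℕ) (x : ℝ) : cut n x ≤ 1 := max_le (by norm_num) (min_le_left _ _)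
lemma cut_mono (x : ℝ) : Monotone fun n => cut n x := by
  intro m n h
  unfold cut
  have : (m : ℝ) ≤ n := by exact_mod_cast h
  exact max_le_max le_rfl (min_le_min le_rfl (by linarith))
lemma cut_one {n : ℕ} {x : ℝ} (h : |x| ≤ n) : cut n x = 1 := by
  unfold cut
  rw [min_eq_left (by linarith), max_eq_right (by norm_num)]
lemma cut_compact (n : ℕ) (g : ℝ → ℝ) : HasCompactSupport fun x => g x * cut n x := by
  refine HasCompactSupport.intro (isCompact_Icc (a := -((n : ℝ) + 1)) (b := n + 1)) fun x hx => ?_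
  have : (n : ℝ) + 1 < |x| := by
    by_contra h
    exact hx (abs_le.1 (not_lt.1 h))
  unfold cut
  rw [max_eq_left, mul_zero]
  exact (min_le_right _ _).trans (by linarith)

/-- cut off function -/
noncomputable def cutC (n : ℕ) (g : ℝ → ℝ) (hg : Continuous g) : C_c(ℝ, ℝ) :=
  ⟨⟨fun x => g x * cut n x, hg.mul (cut_cont n)⟩, cut_compact n g⟩

lemma cutC_apply (n : ℕ) (g : ℝ → ℝ) (hg : Continuous g) (x : ℝ) :
    cutC n g hg x = g x * cut n x := rfl

lemma rmk_le {A : H →L[ℂ] H} (hA : IsSelfAdjoint A) (u : H) {g : ℝ → ℝ} (hg : Continuous g)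
    (hg0 : ∀ x, 0 ≤ g x) :
    ∫⁻ x, ENNReal.ofReal (g x) ∂(RealRMK.rieszMeasure (LamP A hA u)) ≤
      ENNReal.ofReal (Lam A u g) := by
  set μ := RealRMK.rieszMeasure (LamP A hA u) with hμ
  have h1 : Tendsto (fun n => ∫⁻ x, ENNReal.ofReal (g x * cut n x) ∂μ) atTop
      (𝓝 (∫⁻ x, ENNReal.ofReal (g x) ∂μ)) := by
    refine lintegral_tendsto_of_tendsto_of_monotone ?_ ?_ ?_
    · intro n
      have := hg.mul (cut_cont n)
      exact (this.measurable.ennreal_ofReal).aemeasurable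
    · refine Eventually.of_forall fun x m n h => ?_
      exact ENNReal.ofReal_le_ofReal (mul_le_mul_of_nonneg_left (cut_mono x h) (hg0 x))
    · refine Eventually.of_forall fun x => ?_
      refine tendsto_const_nhds.congr' ?_
      filter_upwards [eventually_ge_atTop ⌈|x|⌉₊] with n hn
      rw [cut_one (Nat.ceil_le.1 hn), mul_one]
  refine le_of_tendsto' h1 fun n => ?_
  have h2 := RealRMK.integral_rieszMeasure (LamP A hA u) (cutC n g hg)
  rw [← ofReal_integral_eq_lintegral_ofReal]
  · refine ENNReal.ofReal_le_ofReal ?_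
    calc _ = Lam A u (cutC n g hg) := h2
      _ ≤ Lam A u g := Lam_mono hA u (cutC n g hg).continuous hg fun x => by
        rw [cutC_apply]
        exact mul_le_of_le_one_right (hg0 x) (cut_le n x)
  · exact (hg.mul (cut_cont n)).integrable_of_hasCompactSupport (cut_compact n g)
  · exact Eventually.of_forall fun x => mul_nonneg (hg0 x) (cut_nonneg n x)

lemma pk_lower {U : Set ℝ} (hU : IsOpen U) {x : ℝ} (hx : x ∈ U) :
    ∀ᶠ n : ℕ in atTop, (1 : ENNReal) ≤ ∫⁻ t in U, ENNReal.ofReal (pk t (1 / ((n : ℝ) + 1)) x) := by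
  obtain ⟨δ, hδ, hball⟩ := Metric.isOpen_iff.1 hU x hx
  filter_upwards [(tendsto_one_div_add_atTop_nhds_zero_nat (𝕜 := ℝ)).eventually_lt_const hδ] with n hn
  set ε : ℝ := 1 / ((n : ℝ) + 1) with hε
  have hε0 : 0 < ε := by positivity
  calc (1 : ENNReal) = ENNReal.ofReal (1 / (2 * ε)) * volume (Set.Ioo (x - ε) (x + ε)) := by
        rw [Real.volume_Ioo, ← ENNReal.ofReal_mul (by positivity)]
        rw [show 1 / (2 * ε) * (x + ε - (x - ε)) = 1 by field_simp; ring]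
        simp
    _ = ∫⁻ t in Set.Ioo (x - ε) (x + ε), ENNReal.ofReal (1 / (2 * ε)) := by simp
    _ ≤ ∫⁻ t in Set.Ioo (x - ε) (x + ε), ENNReal.ofReal (pk t ε x) := by
        refine setLIntegral_mono' measurableSet_Ioo fun t ht => ENNReal.ofReal_le_ofReal ?_
        unfold pk
        have h1 : (x - t) ^ 2 ≤ ε ^ 2 := by
          apply sq_le_sq' <;> linarith [ht.1, ht.2]
        rw [div_le_div_iff₀ (by positivity) (by positivity)]
        nlinarith
    _ ≤ _ := by
        refine lintegral_mono_set fun t ht => hball ?_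
        rw [Metric.mem_ball, Real.dist_eq, abs_lt]
        constructor <;> linarith [ht.1, ht.2]

lemma rmk_ac {A : H →L[ℂ] H} (hA : IsSelfAdjoint A) (u : H)
    [IsFiniteMeasure (RealRMK.rieszMeasure (LamP A hA u))] :
    RealRMK.rieszMeasure (LamP A hA u) ≪ volume := by
  set μ := RealRMK.rieszMeasure (LamP A hA u) with hμ
  have hopen : ∀ U : Set ℝ, IsOpen U → μ U ≤ ENNReal.ofReal Real.pi * volume U := by
    intro U hU
    let f : ℕ → ℝ → ENNReal := fun n x => ∫⁻ t in U, ENNReal.ofReal (pk t (1 / ((n : ℝ) + 1)) x)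
    have hmeas : ∀ n : ℕ, Measurable fun q : ℝ × ℝ => ENNReal.ofReal (pk q.2 (1 / ((n : ℝ) + 1)) q.1) := by
      intro n
      unfold pk
      fun_prop
    have hf : ∀ n, Measurable (f n) := fun n => (hmeas n).lintegral_prod_right'
    have hle : ∀ n, ∫⁻ x, f n x ∂μ ≤ ENNReal.ofReal Real.pi * volume U := by
      intro n
      have hp : 0 < 1 / ((n : ℝ) + 1) := by positivity
      simp only [f]
      rw [lintegral_lintegral_swap (hmeas n).aemeasurable]
      calc _ ≤ ∫⁻ t in U, ENNReal.ofReal Real.pi := by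
            refine lintegral_mono fun t => ?_
            refine (rmk_le hA u (pk_cont t hp) (fun x => pk_nonneg t x hp)).trans ?_
            exact ENNReal.ofReal_le_ofReal (Lam_pk hA u t hp)
        _ = _ := by simp
    calc μ U = ∫⁻ x in U, 1 ∂μ := by simp
      _ ≤ ∫⁻ x in U, liminf (fun n => f n x) atTop ∂μ := by
          refine setLIntegral_mono' hU.measurableSet fun x hx => ?_
          exact le_liminf_of_le (by isBoundedDefault) (pk_lower hU hx)
      _ ≤ ∫⁻ x, liminf (fun n => f n x) atTop ∂μ := setLIntegral_le_lintegral _ _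
      _ ≤ liminf (fun n => ∫⁻ x, f n x ∂μ) atTop := lintegral_liminf_le hf
      _ ≤ _ := liminf_le_of_le (by isBoundedDefault) fun b hb => by
          obtain ⟨n, hn⟩ := hb.exists
          exact hn.trans (hle n)
  refine Measure.AbsolutelyContinuous.mk fun s _ h0 => ?_
  refine le_antisymm (le_of_forall_gt fun c hc => ?_) bot_le
  have hpi : ENNReal.ofReal Real.pi ≠ 0 := by simp [Real.pi_pos]
  have hc' : volume s < c / ENNReal.ofReal Real.pi := by
    rw [h0]; exact ENNReal.div_pos hc.ne' ENNReal.ofReal_ne_top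
  obtain ⟨U, hsU, hU, hlt⟩ := Set.exists_isOpen_lt_of_lt s _ hc'
  calc μ s ≤ μ U := measure_mono hsU
    _ ≤ ENNReal.ofReal Real.pi * volume U := hopen U hU
    _ < c := by
      rw [mul_comm]
      exact (ENNReal.lt_div_iff_mul_lt (Or.inl hpi) (Or.inl ENNReal.ofReal_ne_top)).1 hlt

lemma exists_xi_one {A : H →L[ℂ] H} (hA : IsSelfAdjoint A) (u : H) {M : ℝ}
    (hM : ∀ s ∈ Set.Icc (0:ℝ) 1, ‖seg A (rk u) s‖ ≤ M) :
    ∃ ξ : ℝ → ℝ, Integrable ξ ∧ (∀ x, 0 ≤ ξ x) ∧ (∫ x, ξ x ≤ ‖u‖ ^ 2) ∧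
      (∀ x, x ∉ Set.Icc (-M) M → ξ x = 0) ∧
      ∀ f : ℝ → ℝ, Continuous f → ∫ x, f x * ξ x = Lam A u f := by
  set μ := RealRMK.rieszMeasure (LamP A hA u) with hμ
  have hmass : μ Set.univ ≤ ENNReal.ofReal (‖u‖ ^ 2) := by
    have := rmk_le hA u (g := fun _ => 1) continuous_const (fun _ => zero_le_one)
    rw [Lam_one hA u] at this
    simpa using this
  have : IsFiniteMeasure μ := ⟨hmass.trans_lt ENNReal.ofReal_lt_top⟩
  have hac : μ ≪ volume := rmk_ac hA u
  have hsupp : ∀ᵐ x ∂μ, |x| ≤ M := by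
    have hgc : Continuous fun x : ℝ => max 0 (|x| - M) := by fun_prop
    have h1 := rmk_le hA u (g := fun x => max 0 (|x| - M)) hgc (fun _ => le_max_left _ _)
    have h2 : Lam A u (fun x => max 0 (|x| - M)) = Lam A u (fun x => 0 * 1) :=
      Lam_congr u hM fun x hx => by simp [hx]
    rw [h2, Lam_smul hA u 0 (f := fun _ => 1) continuous_const] at h1
    simp only [zero_mul, ENNReal.ofReal_zero, nonpos_iff_eq_zero] at h1
    rw [lintegral_eq_zero_iff hgc.measurable.ennreal_ofReal] at h1
    filter_upwards [h1] with x hx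
    by_contra h
    have : 0 < max 0 (|x| - M) := lt_max_of_lt_right (by linarith [not_le.1 h])
    have := ENNReal.ofReal_pos.2 this
    simp only [Pi.zero_apply] at hx
    rw [hx] at this
    exact lt_irrefl _ this
  set S := Set.Icc (-M) M with hS
  have hSm : MeasurableSet S := measurableSet_Icc
  have hSae : ∀ᵐ x ∂μ, x ∈ S := by filter_upwards [hsupp] with x hx using abs_le.1 hx
  refine ⟨S.indicator fun x => (μ.rnDeriv volume x).toReal, ?_, ?_, ?_, ?_, ?_⟩
  · exact Measure.integrable_toReal_rnDeriv.indicator hSm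
  · intro x; exact Set.indicator_nonneg (fun _ _ => ENNReal.toReal_nonneg) x
  · rw [integral_indicator hSm]
    refine (setIntegral_le_integral Measure.integrable_toReal_rnDeriv
      (Eventually.of_forall fun _ => ENNReal.toReal_nonneg)).trans ?_
    rw [Measure.integral_toReal_rnDeriv hac]
    exact ENNReal.toReal_le_of_le_ofReal (by positivity) hmass
  · intro x hx; exact Set.indicator_of_notMem hx _
  · intro f hf
    obtain ⟨n, hn⟩ := exists_nat_ge M
    have e1 : ∀ x, f x * S.indicator (fun x => (μ.rnDeriv volume x).toReal) x =
        (μ.rnDeriv volume x).toReal • S.indicator f x := by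
      intro x
      by_cases hx : x ∈ S
      · simp [hx, mul_comm]
      · simp [hx]
    simp_rw [e1]
    rw [integral_rnDeriv_smul hac]
    have h2 := RealRMK.integral_rieszMeasure (LamP A hA u) (cutC n f hf)
    rw [LamP_apply] at h2
    have h3 : Lam A u (cutC n f hf) = Lam A u f := Lam_congr u hM fun x hx => by
      rw [cutC_apply, cut_one (hx.trans hn), mul_one]
    rw [← h3, ← h2]
    refine integral_congr_ae ?_
    filter_upwards [hSae, hsupp] with x hx hx'
    rw [Set.indicator_of_mem hx, cutC_apply, cut_one (hx'.trans hn), mul_one]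

end K5

section K6
set_option linter.unusedSectionVars false
set_option linter.unusedSimpArgs false
set_option linter.unusedVariables false
set_option linter.deprecated false
open Filter Topology
variable {H : Type*} [NormedAddCommGroup H] [InnerProductSpace ℂ H] [CompleteSpace H]
variable {ι : Type*} {e : HilbertBasis ι ℂ H}

lemma l1_sum {F : ℕ → ℝ → ℝ} {c : ℕ → ℝ} (hF : ∀ k, Integrable (F k))
    (hc : ∀ k, ∫ x, |F k x| ≤ c k) (hs : Summable c) :
    Integrable (fun x => ∑' k, F k x) ∧ ∫ x, |∑' k, F k x| ≤ ∑' k, c k := by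
  have hc0 : ∀ k, 0 ≤ c k := fun k => (integral_nonneg fun x => abs_nonneg _).trans (hc k)
  have h1 : ∫⁻ x, ∑' k, ‖F k x‖ₑ ≤ ENNReal.ofReal (∑' k, c k) := by
    rw [lintegral_tsum fun k => (hF k).1.enorm, ENNReal.ofReal_tsum_of_nonneg hc0 hs]
    refine ENNReal.tsum_le_tsum fun k => ?_
    rw [← ofReal_integral_norm_eq_lintegral_enorm (hF k)]
    exact ENNReal.ofReal_le_ofReal (hc k)
  have h2 : ∀ᵐ x, ∑' k, ‖F k x‖ₑ < ⊤ :=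
    ae_lt_top' (AEMeasurable.ennreal_tsum fun k => (hF k).1.enorm)
      (h1.trans_lt ENNReal.ofReal_lt_top).ne
  have hm : AEStronglyMeasurable (fun x => ∑' k, F k x) volume := by
    refine aestronglyMeasurable_of_tendsto_ae atTop
      (f := fun (n : ℕ) (x : ℝ) => ∑ k ∈ Finset.range n, F k x) ?_ ?_
    · intro n
      exact (integrable_finset_sum _ fun k _ => hF k).1
    · filter_upwards [h2] with x hx
      have : Summable fun k => ‖F k x‖ := by
        have : ∑' k, ((‖F k x‖₊ : NNReal) : ENNReal) ≠ ⊤ := hx.ne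
        have h3 := ENNReal.tsum_coe_ne_top_iff_summable.1 this
        exact NNReal.summable_coe.2 h3
      exact (Summable.of_norm this).hasSum.tendsto_sum_nat
  have h3 : ∫⁻ x, ‖∑' k, F k x‖ₑ ≤ ENNReal.ofReal (∑' k, c k) :=
    (lintegral_mono fun x => enorm_tsum_le_tsum_enorm).trans h1
  have hi : Integrable (fun x => ∑' k, F k x) := ⟨hm, h3.trans_lt ENNReal.ofReal_lt_top⟩
  refine ⟨hi, ?_⟩
  rw [← ofReal_integral_norm_eq_lintegral_enorm hi] at h3
  exact (ENNReal.ofReal_le_ofReal_iff (tsum_nonneg hc0)).1 h3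

lemma rep_rk (u : H) : Rep (rk u) (fun _ : Unit => u) (fun _ => 1) where
  sm := (hasSum_fintype _).summable
  sg := by simp
  hs := fun x y => by
    have := hasSum_fintype (fun _ : Unit => ((1 : ℝ) : ℂ) * (⟪x, u⟫_ℂ * ⟪u, y⟫_ℂ))
    simp only [Finset.univ_unique, Finset.sum_singleton] at this
    rw [rk_apply, inner_smul_right]
    convert this using 1
    simp; ring

lemma seg_norm_le {A V : H →L[ℂ] H} {M : ℝ} (h0 : ‖A‖ ≤ M) (h1 : ‖A + V‖ ≤ M) {s : ℝ}
    (hs : s ∈ Set.Icc (0:ℝ) 1) : ‖seg A V s‖ ≤ M := by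
  have e1 : seg A V s = ((1 - s : ℝ) : ℂ) • A + (s : ℂ) • (A + V) := by
    unfold seg; push_cast; module
  rw [e1]
  refine (norm_add_le _ _).trans ?_
  rw [norm_smul, norm_smul, Complex.norm_real, Complex.norm_real, Real.norm_of_nonneg hs.1,
    Real.norm_of_nonneg (by linarith [hs.2])]
  have := mul_le_mul_of_nonneg_left h0 (by linarith [hs.2] : 0 ≤ 1 - s)
  have := mul_le_mul_of_nonneg_left h1 hs.1
  linarith

lemma sa_inner_real {B : H →L[ℂ] H} (hB : IsSelfAdjoint B) (x : H) :
    ⟪x, B x⟫_ℂ = (((⟪x, B x⟫_ℂ).re : ℝ) : ℂ) := by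
  have hs : ⟪B x, x⟫_ℂ = ⟪x, B x⟫_ℂ :=
    (ContinuousLinearMap.isSelfAdjoint_iff_isSymmetric).1 hB x x
  have h2 : (starRingEnd ℂ) ⟪x, B x⟫_ℂ = ⟪x, B x⟫_ℂ := by rw [inner_conj_symm, hs]
  exact (Complex.conj_eq_iff_re.1 h2).symm

lemma xi_pos {A : H →L[ℂ] H} (hA : IsSelfAdjoint A) (u : H) {M : ℝ} (h0 : ‖A‖ ≤ M)
    (h1 : ‖A + rk u‖ ≤ M) :
    ∃ ξ : ℝ → ℝ, Integrable ξ ∧ (∀ x, 0 ≤ ξ x) ∧ (∫ x, ξ x ≤ ‖u‖ ^ 2) ∧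
      (∀ x, x ∉ Set.Icc (-M) M → ξ x = 0) ∧
      ∀ n : ℕ, HasTr e ((A + rk u) ^ n - A ^ n)
        ((∫ x, ((n : ℝ) * x ^ (n - 1)) * ξ x : ℝ) : ℂ) := by
  obtain ⟨ξ, a1, a2, a3, a4, a5⟩ := exists_xi_one hA u (M := M) fun s hs => seg_norm_le h0 h1 hs
  refine ⟨ξ, a1, a2, a3, a4, fun n => ?_⟩
  have h := (rep_rk u).hasTr_pow (e := e) A n
  rw [a5 _ (by fun_prop), Lam]
  convert h using 1
  rw [← intervalIntegral.integral_ofReal]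
  congr 1
  funext s
  have hB := seg_sa hA (rk_sa u) s
  rw [cfc_const_mul (n : ℝ) (fun x => x ^ (n - 1)) _ (by fun_prop), cfc_pow_id _ (n - 1) hB]
  have e1 : ((n : ℝ) • seg A (rk u) s ^ (n - 1)) u = (n : ℂ) • (seg A (rk u) s ^ (n - 1)) u := by
    rw [ContinuousLinearMap.smul_apply]
    rw [← Complex.ofReal_natCast]; rfl
  rw [e1, inner_smul_right, sa_inner_real (hB.pow (n - 1))]
  unfold tau
  simp only [tsum_fintype, Finset.univ_unique, Finset.sum_singleton]
  simp only [Complex.ofReal_one, one_mul]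
  rw [sa_inner_real (hB.pow (n - 1))]
  norm_cast

lemma xi_sgn {A : H →L[ℂ] H} (hA : IsSelfAdjoint A) (u : H) {σ : ℝ} (hσ : σ = 1 ∨ σ = -1)
    {M : ℝ} (h0 : ‖A‖ ≤ M) (h1 : ‖A + (σ : ℂ) • rk u‖ ≤ M) :
    ∃ ξ : ℝ → ℝ, Integrable ξ ∧ (∀ x, 0 ≤ σ * ξ x) ∧ (u = 0 → ∀ x, ξ x = 0) ∧
      (∫ x, |ξ x| ≤ ‖u‖ ^ 2) ∧
      (∀ x, x ∉ Set.Icc (-M) M → ξ x = 0) ∧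
      ∀ n : ℕ, HasTr e ((A + (σ : ℂ) • rk u) ^ n - A ^ n)
        ((∫ x, ((n : ℝ) * x ^ (n - 1)) * ξ x : ℝ) : ℂ) := by
  rcases eq_or_ne u 0 with rfl | hu
  · refine ⟨fun _ => 0, integrable_zero _ _ _, by simp, by simp, by simp, by simp, fun n => ?_⟩
    have : rk (0 : H) = 0 := by ext; simp [rk_apply]
    simpa [this] using HasTr.zero (e := e)
  rcases hσ with rfl | rfl
  · simp only [Complex.ofReal_one, one_smul] at h1 ⊢
    obtain ⟨ξ, a1, a2, a3, a4, a5⟩ := xi_pos (e := e) hA u h0 h1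
    refine ⟨ξ, a1, by simpa using a2, fun h => (hu h).elim, ?_, a4, a5⟩
    simpa only [abs_of_nonneg (a2 _)] using a3
  · have e0 : A + ((-1 : ℝ) : ℂ) • rk u = A - rk u := by
      push_cast; module
    rw [e0] at h1 ⊢
    have e1 : A - rk u + rk u = A := by abel
    obtain ⟨ξ, a1, a2, a3, a4, a5⟩ := xi_pos (e := e) (hA.sub (rk_sa u)) u h1 (by rw [e1]; exact h0)
    refine ⟨fun x => - ξ x, a1.neg, by simpa using a2, fun h => (hu h).elim, ?_,
      fun x hx => by simp [a4 x hx], fun n => ?_⟩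
    · simpa only [abs_neg, abs_of_nonneg (a2 _)] using a3
    · have := (a5 n).smul (-1)
      rw [e1] at this
      simp only [mul_neg, integral_neg]
      convert this using 1
      · module
      · push_cast; ring

lemma norm_pow_sub {X Y : H →L[ℂ] H} {M : ℝ} (hX : ‖X‖ ≤ M) (hY : ‖Y‖ ≤ M) (n : ℕ) :
    ‖X ^ n - Y ^ n‖ ≤ n * M ^ (n - 1) * ‖X - Y‖ := by
  have hM : 0 ≤ M := (norm_nonneg X).trans hX
  have hp : ∀ (Z : H →L[ℂ] H) (k : ℕ), ‖Z‖ ≤ M → ‖Z ^ k‖ ≤ M ^ k := by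
    intro Z k hZ
    induction k with
    | zero => rw [pow_zero, pow_zero]; exact ContinuousLinearMap.norm_id_le
    | succ k ih =>
      rw [pow_succ, pow_succ]
      exact (norm_mul_le _ _).trans (mul_le_mul ih hZ (norm_nonneg _) (by positivity))
  rw [pow_sub_pow_nc]
  refine (norm_sum_le _ _).trans ?_
  calc _ ≤ ∑ j ∈ Finset.range n, M ^ (n - 1) * ‖X - Y‖ := by
        refine Finset.sum_le_sum fun j hj => ?_
        have hj' := Finset.mem_range.1 hj
        calc _ ≤ ‖X ^ j‖ * ‖X - Y‖ * ‖Y ^ (n - 1 - j)‖ :=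
              (norm_mul_le _ _).trans (mul_le_mul_of_nonneg_right (norm_mul_le _ _) (norm_nonneg _))
          _ ≤ M ^ j * ‖X - Y‖ * M ^ (n - 1 - j) := by
              gcongr
              · exact hp X j hX
              · exact hp Y _ hY
          _ = M ^ (j + (n - 1 - j)) * ‖X - Y‖ := by rw [pow_add]; ring
          _ = _ := by rw [show j + (n - 1 - j) = n - 1 by omega]
    _ = _ := by simp; ring

lemma rep_hasSum {V : H →L[ℂ] H} {u : ℕ → H} {σ : ℕ → ℝ} (h : Rep V u σ) :
    HasSum (fun k => (σ k : ℂ) • rk (u k)) V := by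
  have hs : Summable fun k => (σ k : ℂ) • rk (u k) := by
    refine Summable.of_norm_bounded h.sm fun k => ?_
    rw [norm_smul, rk_norm, Complex.norm_real]
    exact mul_le_of_le_one_left (by positivity) (h.sg k)
  have hV := hs.hasSum
  have : ∑' k, (σ k : ℂ) • rk (u k) = V := by
    ext y
    refine ext_inner_left ℂ fun x => ?_
    have h1 : HasSum (fun k => ⟪x, ((σ k : ℂ) • rk (u k)) y⟫_ℂ)
        ⟪x, (∑' k, (σ k : ℂ) • rk (u k)) y⟫_ℂ := by
      have := hV.mapL ((innerSL ℂ x).comp (ContinuousLinearMap.apply ℂ H y))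
      simpa using this
    refine h1.unique ?_
    convert h.hs x y using 2 with k
    rw [ContinuousLinearMap.smul_apply, rk_apply, inner_smul_right, inner_smul_right]
    ring
  rwa [this] at hV

theorem xi_exists [TopologicalSpace.SeparableSpace H] {A0 A1 : H →L[ℂ] H} (h0 : IsSelfAdjoint A0)
    (h1 : IsSelfAdjoint A1) (hV : IsTraceClass e (A1 - A0)) :
    ∃ (u : ℕ → H) (σ : ℕ → ℝ) (ξ : ℝ → ℝ) (M : ℝ), 0 ≤ M ∧ ‖A0‖ ≤ M ∧ ‖A1‖ ≤ M ∧
      Rep (A1 - A0) u σ ∧ ∑' k, ‖u k‖ ^ 2 = traceNorm e (A1 - A0) ∧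
      Integrable ξ ∧ (∀ x, x ∉ Set.Icc (-M) M → ξ x = 0) ∧
      (∫ x, |ξ x| ≤ traceNorm e (A1 - A0)) ∧
      ((A1 - A0).IsPositive → ∀ x, 0 ≤ ξ x) ∧
      ((-(A1 - A0)).IsPositive → ∀ x, ξ x ≤ 0) ∧
      ∀ n : ℕ, HasTr e (A1 ^ n - A0 ^ n) ((∫ x, ((n : ℝ) * x ^ (n - 1)) * ξ x : ℝ) : ℂ) := by
  obtain ⟨u, σ, hR, hσ, htn, hp, hn⟩ := exists_rep_seq (h1.sub h0) hV
  set M : ℝ := ‖A0‖ + ∑' k, ‖u k‖ ^ 2 with hM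
  have hS0 : 0 ≤ ∑' k, ‖u k‖ ^ 2 := tsum_nonneg fun k => by positivity
  have hM0 : 0 ≤ M := by positivity
  let B : ℕ → H →L[ℂ] H := fun N => A0 + ∑ k ∈ Finset.range N, (σ k : ℂ) • rk (u k)
  have hB0 : B 0 = A0 := by simp [B]
  have hBs : ∀ N, B (N + 1) = B N + (σ N : ℂ) • rk (u N) := by
    intro N; simp only [B]; rw [Finset.sum_range_succ]; abel
  have hnr : ∀ k, ‖(σ k : ℂ) • rk (u k)‖ ≤ ‖u k‖ ^ 2 := by
    intro k
    rw [norm_smul, rk_norm, Complex.norm_real]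
    exact mul_le_of_le_one_left (by positivity) (hR.sg k)
  have hBM : ∀ N, ‖B N‖ ≤ M := by
    intro N
    refine (norm_add_le _ _).trans (add_le_add le_rfl ?_)
    refine (norm_sum_le _ _).trans ((Finset.sum_le_sum fun k _ => hnr k).trans ?_)
    exact hR.sm.sum_le_tsum _ fun k _ => by positivity
  have hBsa : ∀ N, IsSelfAdjoint (B N) := by
    intro N
    refine h0.add ?_
    induction N with
    | zero => simp
    | succ N ih =>
      rw [Finset.sum_range_succ]
      exact ih.add (IsSelfAdjoint.smul (by simp [IsSelfAdjoint]) (rk_sa _))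
  have hBt : Tendsto B atTop (𝓝 A1) := by
    have := (rep_hasSum hR).tendsto_sum_nat.const_add A0
    rwa [add_sub_cancel] at this
  have hA1M : ‖A1‖ ≤ M := le_of_tendsto' hBt.norm hBM
  have hstep : ∀ N, ∃ ξ : ℝ → ℝ, Integrable ξ ∧ (∀ x, 0 ≤ σ N * ξ x) ∧ (u N = 0 → ∀ x, ξ x = 0) ∧
      (∫ x, |ξ x| ≤ ‖u N‖ ^ 2) ∧
      (∀ x, x ∉ Set.Icc (-M) M → ξ x = 0) ∧
      ∀ n : ℕ, HasTr e (B (N + 1) ^ n - B N ^ n)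
        ((∫ x, ((n : ℝ) * x ^ (n - 1)) * ξ x : ℝ) : ℂ) := by
    intro N
    rw [hBs]
    exact xi_sgn (hBsa N) (u N) (hσ N) (hBM N) (by rw [← hBs]; exact hBM _)
  choose X b1 b2 b3 b4 b5 b6 using hstep
  obtain ⟨c1, c2⟩ := l1_sum b1 b4 hR.sm
  refine ⟨u, σ, fun x => ∑' k, X k x, M, hM0, by linarith, hA1M, hR, htn, c1, ?_, htn ▸ c2, ?_, ?_, ?_⟩
  · intro x hx
    simp [b5 _ x hx]
  · intro hpos x
    refine tsum_nonneg fun k => ?_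
    rcases hp hpos k with h | h
    · simpa [h] using b2 k x
    · rw [b3 k h]
  · intro hneg x
    refine tsum_nonpos fun k => ?_
    rcases hn hneg k with h | h
    · simpa [h] using b2 k x
    · rw [b3 k h]
  · intro n
    have hnb : ∀ N, NB e (B (N + 1) ^ n - B N ^ n) (n * M ^ (n - 1) * ‖u N‖ ^ 2) := by
      intro N
      refine NB.pow ?_ hM0 (hBM _) (hBM _) n
      rw [hBs, add_sub_cancel_left]
      have := ((rep_rk (u N)).nb (e := e)).smul (σ N : ℂ)
      refine NB.mono this ?_
      simp only [tsum_fintype, Finset.univ_unique, Finset.sum_singleton]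
      rw [Complex.norm_real]
      exact mul_le_of_le_one_left (by positivity) (hR.sg N)
    have hsm : Summable fun N => (n * M ^ (n - 1) * ‖u N‖ ^ 2 : ℝ) := hR.sm.mul_left _
    have hHS : HasSum (fun N => B (N + 1) ^ n - B N ^ n) (A1 ^ n - A0 ^ n) := by
      have hsum : Summable fun N => B (N + 1) ^ n - B N ^ n := by
        refine Summable.of_norm_bounded hsm fun N => ?_
        refine (norm_pow_sub (hBM _) (hBM _) n).trans ?_
        refine mul_le_mul_of_nonneg_left ?_ (by positivity)
        rw [hBs, add_sub_cancel_left]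
        exact hnr N
      refine (hsum.hasSum_iff_tendsto_nat).2 ?_
      have e1 : ∀ N, ∑ i ∈ Finset.range N, (B (i + 1) ^ n - B i ^ n) = B N ^ n - A0 ^ n := by
        intro N; rw [Finset.sum_range_sub (fun i => B i ^ n), hB0]
      simp_rw [e1]
      exact (hBt.pow n).sub_const _
    have hT := (HasTr.tsum (fun N => b6 N n) hnb hsm hHS).1
    convert hT using 1
    have hbd : ∀ k, Integrable fun x => ((n : ℝ) * x ^ (n - 1)) * X k x := by
      intro k
      have e1 : (fun x => ((n : ℝ) * x ^ (n - 1)) * X k x) =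
          (Set.Icc (-M) M).indicator fun x => ((n : ℝ) * x ^ (n - 1)) * X k x := by
        funext x
        by_cases hx : x ∈ Set.Icc (-M) M
        · simp [hx]
        · simp [hx, b5 k x hx]
      rw [e1, integrable_indicator_iff measurableSet_Icc]
      refine IntegrableOn.continuousOn_mul (by fun_prop) (b1 k).integrableOn isCompact_Icc
    have hsb : ∀ k, ∫ x, ‖((n : ℝ) * x ^ (n - 1)) * X k x‖ ≤ n * M ^ (n - 1) * ‖u k‖ ^ 2 := by
      intro k
      calc _ ≤ ∫ x, n * M ^ (n - 1) * |X k x| := by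
            refine integral_mono (hbd k).norm ((b1 k).abs.const_mul _) fun x => ?_
            show ‖((n : ℝ) * x ^ (n - 1)) * X k x‖ ≤ n * M ^ (n - 1) * |X k x|
            by_cases hx : x ∈ Set.Icc (-M) M
            · rw [norm_mul, norm_mul, norm_pow, Real.norm_natCast]
              have : ‖x‖ ≤ M := abs_le.2 hx
              have h' : ‖X k x‖ = |X k x| := rfl
              rw [h']
              gcongr
            · simp [b5 k x hx]
        _ = n * M ^ (n - 1) * ∫ x, |X k x| := integral_const_mul _ _
        _ ≤ _ := by gcongr; exact b4 k
    have := hasSum_integral_of_summable_integral_norm hbd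
      (Summable.of_nonneg_of_le (fun k => integral_nonneg fun x => norm_nonneg _) hsb hsm)
    have h2 := this.tsum_eq
    rw [← Complex.ofReal_tsum, h2]
    congr 1
    refine integral_congr_ae (Eventually.of_forall fun x => ?_)
    show _ = ∑' i, ((n : ℝ) * x ^ (n - 1)) * X i x
    rw [tsum_mul_left]

end K6

section K7
set_option linter.unusedSectionVars false
set_option linter.unusedSimpArgs false
set_option linter.unusedVariables false
set_option linter.deprecated false
open Filter Topology
variable {H : Type*} [NormedAddCommGroup H] [InnerProductSpace ℂ H] [CompleteSpace H]
variable {ι : Type*} {e : HilbertBasis ι ℂ H}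

lemma int_mul {c d : ℝ} {η : ℝ → ℝ} (hη : Integrable η) (hz : ∀ x, x ∉ Set.Icc c d → η x = 0)
    {f : ℝ → ℝ} (hf : Continuous f) : Integrable fun x => f x * η x := by
  have e1 : (fun x => f x * η x) = (Set.Icc c d).indicator fun x => f x * η x := by
    funext x
    by_cases hx : x ∈ Set.Icc c d
    · simp [hx]
    · simp [hx, hz x hx]
  rw [e1, integrable_indicator_iff measurableSet_Icc]
  exact IntegrableOn.continuousOn_mul hf.continuousOn hη.integrableOn isCompact_Icc

lemma lemma_W {a b c d C : ℝ} {η : ℝ → ℝ} (hη : Integrable η)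
    (hz : ∀ x, x ∉ Set.Icc c d → η x = 0) (hC : 0 ≤ C)
    (hq : ∀ (q : ℝ[X]) (ε : ℝ), 0 ≤ ε → (∀ x ∈ Set.Icc a b, |q.eval x| ≤ ε) →
      |∫ x, q.eval x * η x| ≤ C * ε) :
    ∀ᵐ x, x ∉ Set.Icc a b → η x = 0 := by
  have hU : IsOpen (Set.Icc a b)ᶜ := isClosed_Icc.isOpen_compl
  refine hU.ae_eq_zero_of_integral_contDiff_smul_eq_zero
    (hη.locallyIntegrable.locallyIntegrableOn _) fun g hg hgc hgs => ?_
  have hgcont : Continuous g := hg.continuous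
  have key : ∀ ε : ℝ, 0 < ε → |∫ x, g x * η x| ≤ ((∫ x, |η x|) + C) * ε := by
    intro ε hε
    obtain ⟨q, hqa⟩ := exists_polynomial_near_of_continuousOn (min a c) (max b d) g
      hgcont.continuousOn ε hε
    have h1 : |∫ x, q.eval x * η x| ≤ C * ε := by
      refine hq q ε hε.le fun x hx => ?_
      have h0 : g x = 0 := by
        by_contra h
        exact hgs (subset_tsupport g h) hx
      have := hqa x ⟨(min_le_left _ _).trans hx.1, hx.2.trans (le_max_left _ _)⟩
      rw [h0, sub_zero] at this
      exact this.le
    have i1 := int_mul hη hz q.continuous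
    have i2 := int_mul hη hz hgcont
    have h2 : |(∫ x, q.eval x * η x) - ∫ x, g x * η x| ≤ ε * ∫ x, |η x| := by
      rw [← integral_sub i1 i2, ← integral_const_mul, ← Real.norm_eq_abs]
      refine (norm_integral_le_integral_norm _).trans ?_
      refine integral_mono (i1.sub i2).norm (hη.abs.const_mul _) fun x => ?_
      show ‖q.eval x * η x - g x * η x‖ ≤ ε * |η x|
      by_cases hx : x ∈ Set.Icc c d
      · rw [← sub_mul, norm_mul]
        have := hqa x ⟨(min_le_right _ _).trans hx.1, hx.2.trans (le_max_right _ _)⟩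
        exact mul_le_mul_of_nonneg_right this.le (abs_nonneg _)
      · simp [hz x hx]
    rw [abs_le] at h1 h2 ⊢
    constructor <;> nlinarith
  have : |∫ x, g x * η x| ≤ 0 := by
    refine le_of_forall_pos_le_add fun δ hδ => ?_
    have hK : 0 ≤ (∫ x, |η x|) + C := add_nonneg (integral_nonneg fun x => abs_nonneg _) hC
    have := key (δ / ((∫ x, |η x|) + C + 1)) (by positivity)
    refine this.trans ?_
    rw [zero_add, mul_div_assoc', div_le_iff₀ (by positivity)]
    nlinarith
  simpa using this

lemma poly_int {c d : ℝ} {η : ℝ → ℝ} (hη : Integrable η) (hz : ∀ x, x ∉ Set.Icc c d → η x = 0)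
    (hk : ∀ k : ℕ, ∫ x, ((k : ℝ) * x ^ (k - 1)) * η x = 0) (q : ℝ[X]) :
    ∫ x, q.eval x * η x = 0 := by
  induction q using Polynomial.induction_on' with
  | add p q hp hq =>
    simp only [eval_add, add_mul]
    rw [integral_add (int_mul hη hz p.continuous) (int_mul hη hz q.continuous), hp, hq, add_zero]
  | monomial n r =>
    have h := hk (n + 1)
    simp only [Nat.add_sub_cancel, mul_assoc] at h
    rw [integral_const_mul] at h
    have h0 : ((n + 1 : ℕ) : ℝ) ≠ 0 := by positivity
    have := (mul_eq_zero.1 h).resolve_left h0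
    simp only [eval_monomial, mul_assoc]
    rw [integral_const_mul, this, mul_zero]

lemma xi_unique {a b : ℝ} {ξ ξ' : ℝ → ℝ} (h : Integrable ξ) (h' : Integrable ξ')
    (hz : ∀ x, x ∉ Set.Icc a b → ξ x = 0) (hz' : ∀ x, x ∉ Set.Icc a b → ξ' x = 0)
    (hk : ∀ n : ℕ, ∫ x, ((n : ℝ) * x ^ (n - 1)) * ξ' x = ∫ x, ((n : ℝ) * x ^ (n - 1)) * ξ x) :
    ξ' =ᵐ[volume] ξ := by
  have hd : Integrable fun x => ξ' x - ξ x := h'.sub h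
  have hzd : ∀ x, x ∉ Set.Icc a b → ξ' x - ξ x = 0 := fun x hx => by rw [hz x hx, hz' x hx, sub_zero]
  have := lemma_W (a := 1) (b := 0) (C := 0) hd hzd le_rfl fun q ε hε _ => by
    rw [poly_int hd hzd ?_ q]
    · simp
    · intro k
      simp only [mul_sub]
      rw [integral_sub (int_mul h' hz' (by fun_prop)) (int_mul h hz (by fun_prop)), hk, sub_self]
  filter_upwards [this] with x hx
  have := hx (by simp)
  linarith

lemma exists_antideriv (p : ℝ[X]) : ∃ q : ℝ[X], derivative q = p := by
  induction p using Polynomial.induction_on' with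
  | add p q hp hq =>
    obtain ⟨a, rfl⟩ := hp
    obtain ⟨b, rfl⟩ := hq
    exact ⟨a + b, by simp⟩
  | monomial n r =>
    refine ⟨monomial (n + 1) (r / (n + 1)), ?_⟩
    rw [derivative_monomial]
    have : (n : ℝ) + 1 ≠ 0 := by positivity
    congr 1
    push_cast
    field_simp

lemma hasTr_poly_of_pow {A0 A1 : H →L[ℂ] H} {c d : ℝ} {ξ : ℝ → ℝ} (hξ : Integrable ξ)
    (hz : ∀ x, x ∉ Set.Icc c d → ξ x = 0)
    (h : ∀ n : ℕ, HasTr e (A1 ^ n - A0 ^ n) ((∫ x, ((n : ℝ) * x ^ (n - 1)) * ξ x : ℝ) : ℂ))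
    (q : ℝ[X]) :
    HasTr e (aeval A1 q - aeval A0 q) ((∫ x, (derivative q).eval x * ξ x : ℝ) : ℂ) := by
  induction q using Polynomial.induction_on' with
  | add p q hp hq =>
    have := hp.add hq
    simp only [map_add, eval_add, add_mul]
    rw [integral_add (int_mul hξ hz (derivative p).continuous)
      (int_mul hξ hz (derivative q).continuous)]
    convert this using 1
    · abel
    · push_cast; rfl
  | monomial n r =>
    have := (h n).smul (r : ℂ)
    rw [aeval_monomial, aeval_monomial]
    convert this using 1
    · rw [Algebra.algebraMap_eq_smul_one]
      simp only [smul_mul_assoc, one_mul]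
      rw [← smul_sub]; rfl
    · rw [← Complex.ofReal_mul, ← integral_const_mul]
      congr 2; funext x
      simp [derivative_monomial]; ring

lemma seg_spec {A0 A1 : H →L[ℂ] H} {a b : ℝ} (h0 : IsSelfAdjoint A0) (h1 : IsSelfAdjoint A1)
    (hs0 : spectrum ℝ A0 ⊆ Set.Icc a b) (hs1 : spectrum ℝ A1 ⊆ Set.Icc a b) {s : ℝ}
    (hs : s ∈ Set.Icc (0:ℝ) 1) : spectrum ℝ (seg A0 (A1 - A0) s) ⊆ Set.Icc a b := by
  have hsa := seg_sa h0 (h1.sub h0) s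
  have e1 : seg A0 (A1 - A0) s = (1 - s) • A0 + s • A1 := by
    have e2 : (1 - s) • A0 + s • A1 = ((1 - s : ℝ) : ℂ) • A0 + (s : ℂ) • A1 := rfl
    rw [e2]; unfold seg; push_cast; module
  have e3 : ∀ r : ℝ, algebraMap ℝ (H →L[ℂ] H) r =
      (1 - s) • algebraMap ℝ (H →L[ℂ] H) r + s • algebraMap ℝ (H →L[ℂ] H) r := by
    intro r; module
  have p0 : 0 ≤ 1 - s := by linarith [hs.2]
  have l1 : algebraMap ℝ (H →L[ℂ] H) a ≤ seg A0 (A1 - A0) s := by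
    rw [e1, e3 a]
    exact add_le_add
      (smul_le_smul_of_nonneg_left ((algebraMap_le_iff_le_spectrum h0).2 fun x hx => (hs0 hx).1) p0)
      (smul_le_smul_of_nonneg_left ((algebraMap_le_iff_le_spectrum h1).2 fun x hx => (hs1 hx).1) hs.1)
  have l2 : seg A0 (A1 - A0) s ≤ algebraMap ℝ (H →L[ℂ] H) b := by
    rw [e1, e3 b]
    exact add_le_add
      (smul_le_smul_of_nonneg_left ((le_algebraMap_iff_spectrum_le h0).2 fun x hx => (hs0 hx).2) p0)
      (smul_le_smul_of_nonneg_left ((le_algebraMap_iff_spectrum_le h1).2 fun x hx => (hs1 hx).2) hs.1)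
  intro x hx
  exact ⟨(algebraMap_le_iff_le_spectrum hsa).1 l1 x hx, (le_algebraMap_iff_spectrum_le hsa).1 l2 x hx⟩

theorem xi_exists' [TopologicalSpace.SeparableSpace H] {A0 A1 : H →L[ℂ] H} (h0 : IsSelfAdjoint A0)
    (h1 : IsSelfAdjoint A1) (hV : IsTraceClass e (A1 - A0)) {a b : ℝ}
    (hs0 : spectrum ℝ A0 ⊆ Set.Icc a b) (hs1 : spectrum ℝ A1 ⊆ Set.Icc a b) :
    ∃ (ξ : ℝ → ℝ) (M : ℝ), 0 ≤ M ∧ ‖A0‖ ≤ M ∧ ‖A1‖ ≤ M ∧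
      NB e (A1 - A0) (traceNorm e (A1 - A0)) ∧
      Integrable ξ ∧ (∀ x, x ∉ Set.Icc (-M) M → ξ x = 0) ∧ (∀ x, x ∉ Set.Icc a b → ξ x = 0) ∧
      (∫ x, |ξ x| ≤ traceNorm e (A1 - A0)) ∧
      ((A1 - A0).IsPositive → ∀ x, 0 ≤ ξ x) ∧
      ((-(A1 - A0)).IsPositive → ∀ x, ξ x ≤ 0) ∧
      ∀ n : ℕ, HasTr e (A1 ^ n - A0 ^ n) ((∫ x, ((n : ℝ) * x ^ (n - 1)) * ξ x : ℝ) : ℂ) := by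
  obtain ⟨u, σ, ξ, M, hM, hA0, hA1, hR, htn, i1, i2, i3, i4, i5, i6⟩ := xi_exists h0 h1 hV
  have hS0 : 0 ≤ ∑' k, ‖u k‖ ^ 2 := tsum_nonneg fun k => by positivity
  have hae : ∀ᵐ x, x ∉ Set.Icc a b → ξ x = 0 := by
    refine lemma_W i1 i2 hS0 fun p ε hε hp => ?_
    obtain ⟨q, rfl⟩ := exists_antideriv p
    have t1 := hasTr_poly_of_pow i1 i2 i6 q
    have t2 := hR.hasTr_poly (e := e) A0 q
    rw [add_sub_cancel] at t2
    have t3 := HasSum.unique t1 t2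
    rw [← Real.norm_eq_abs, ← Complex.norm_real, t3]
    have : ∀ s ∈ Set.uIoc (0:ℝ) 1,
        ‖tau u σ (aeval (seg A0 (A1 - A0) s) (derivative q))‖ ≤ (∑' k, ‖u k‖ ^ 2) * ε := by
      intro s hs
      rw [Set.uIoc_of_le zero_le_one] at hs
      have hs' : s ∈ Set.Icc (0:ℝ) 1 := ⟨hs.1.le, hs.2⟩
      refine (tau_sm hR.sm hR.sg _).2.trans (mul_le_mul_of_nonneg_left ?_ hS0)
      rw [← cfc_polynomial _ _ (seg_sa h0 (h1.sub h0) s)]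
      exact norm_cfc_le hε fun x hx => hp x (seg_spec h0 h1 hs0 hs1 hs' hx)
    simpa using intervalIntegral.norm_integral_le_of_norm_le_const this
  have hae2 : (Set.Icc a b).indicator ξ =ᵐ[volume] ξ := by
    filter_upwards [hae] with x hx
    by_cases h : x ∈ Set.Icc a b
    · simp [h]
    · simp [h, hx h]
  refine ⟨(Set.Icc a b).indicator ξ, M, hM, hA0, hA1, htn ▸ hR.nb, i1.indicator measurableSet_Icc,
    ?_, ?_, ?_, ?_, ?_, ?_⟩
  · intro x hx
    simp [Set.indicator_apply, i2 x hx]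
  · intro x hx; exact Set.indicator_of_notMem hx _
  · refine le_trans (le_of_eq ?_) i3
    refine integral_congr_ae ?_
    filter_upwards [hae2] with x hx
    rw [hx]
  · intro h x; exact Set.indicator_nonneg (fun x _ => i4 h x) x
  · intro h x; exact Set.indicator_nonpos (fun x _ => i5 h x) x
  · intro n
    convert i6 n using 2
    refine integral_congr_ae ?_
    filter_upwards [hae2] with x hx
    rw [hx]

end K7

section K8
set_option linter.unusedSectionVars false
set_option linter.unusedSimpArgs false
set_option linter.unusedVariables false
set_option linter.deprecated false
open Filter Topology
variable {H : Type*} [NormedAddCommGroup H] [InnerProductSpace ℂ H] [CompleteSpace H]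
variable {ι : Type*} {e : HilbertBasis ι ℂ H}

/-- the operator `exp (i α A)` -/
noncomputable def Eop (α : ℝ) (A : H →L[ℂ] H) : H →L[ℂ] H :=
  fc (fun t => Complex.exp (Complex.I * (α : ℂ) * (t : ℂ))) A

lemma fc_congr {A : H →L[ℂ] H} (h : IsSelfAdjoint A) (f : ℝ → ℂ) (g : ℂ → ℂ)
    (hfg : ∀ t : ℝ, f t = g t) : fc f A = cfc g A := by
  unfold fc
  apply cfc_congr
  intro z hz
  have := h.mem_spectrum_eq_re hz
  simp only [hfg]
  rw [← this]

lemma fc_poly {A : H →L[ℂ] H} (h : IsSelfAdjoint A) (φ : ℝ → ℂ) (p : Polynomial ℂ)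
    (hφ : ∀ t : ℝ, φ t = Polynomial.eval (t : ℂ) p) : fc φ A = aeval A p := by
  rw [fc_congr h φ (fun z => p.eval z) hφ]
  exact cfc_polynomial p A h.isStarNormal

lemma Eop_eq {A : H →L[ℂ] H} (h : IsSelfAdjoint A) (α : ℝ) :
    Eop α A = NormedSpace.exp ((Complex.I * (α : ℂ)) • A) := by
  unfold Eop
  have hn := h.isStarNormal
  rw [fc_congr h _ (fun z => Complex.exp ((Complex.I * (α : ℂ)) * z)) (fun t => rfl)]
  rw [cfc_comp_const_mul (Complex.I * (α : ℂ)) Complex.exp A]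
  have : IsStarNormal ((Complex.I * (α : ℂ)) • A) := by
    infer_instance
  exact CFC.complex_exp_eq_normedSpace_exp

lemma Eop_norm {A : H →L[ℂ] H} (α : ℝ) : ‖Eop α A‖ ≤ 1 := by
  unfold Eop fc
  apply norm_cfc_le zero_le_one
  intro z hz
  rw [Complex.norm_exp]
  simp

lemma Eop_pow {A : H →L[ℂ] H} (h : IsSelfAdjoint A) (α : ℝ) (m : ℕ) (hm : m ≠ 0) :
    Eop (α / m) A ^ m = Eop α A := by
  have hn := h.isStarNormal
  unfold Eop fc
  rw [← cfc_pow (fun z : ℂ => Complex.exp (Complex.I * ((α / m : ℝ) : ℂ) * ((z.re : ℝ) : ℂ))) m A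
    (by fun_prop)]
  apply cfc_congr
  intro z hz
  simp only
  rw [← Complex.exp_nat_mul]
  congr 1
  have : (m : ℂ) ≠ 0 := by exact_mod_cast hm
  push_cast
  field_simp

lemma hasTr_cpoly {A0 A1 : H →L[ℂ] H} {ξ : ℝ → ℝ} {a b : ℝ} (hi : Integrable ξ)
    (hz : ∀ x ∉ Set.Icc a b, ξ x = 0)
    (hp : ∀ n : ℕ, HasTr e (A1 ^ n - A0 ^ n) ((∫ x, ((n : ℝ) * x ^ (n - 1)) * ξ x : ℝ) : ℂ))
    (p : Polynomial ℂ) :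
    HasTr e (aeval A1 p - aeval A0 p) (∫ x : ℝ, (derivative p).eval (x : ℂ) * (ξ x : ℂ)) := by
  have hIntg : ∀ q : Polynomial ℂ, Integrable fun x : ℝ => q.eval (x : ℂ) * (ξ x : ℂ) := by
    intro q
    induction q using Polynomial.induction_on' with
    | add q r hq hr =>
      refine (hq.add hr).congr (Filter.Eventually.of_forall fun x => ?_)
      simp [add_mul]
    | monomial n c =>
      have := (int_mul hi hz (f := fun x => x ^ n) (by fun_prop)).ofReal (𝕜 := ℂ)
      have := this.const_mul c
      refine this.congr (Filter.Eventually.of_forall fun x => ?_)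
      simp [mul_assoc]
  induction p using Polynomial.induction_on' with
  | add q r hq hr =>
    have := hq.add hr
    rw [← integral_add (hIntg _) (hIntg _)] at this
    convert this using 1
    · simp; abel
    · simp [add_mul]
  | monomial n c =>
    have := (hp n).smul c
    convert this using 1
    · simp [aeval_monomial, smul_sub, Algebra.smul_def]
      simp [mul_sub]
    · rw [← integral_complex_ofReal, ← integral_const_mul]
      congr 1; ext x
      simp [derivative_monomial]; ring

lemma nb_cpoly {A0 A1 : H →L[ℂ] H} {M S : ℝ} (h : NB e (A1 - A0) S) (hM : 0 ≤ M)
    (h1 : ‖A1‖ ≤ M) (h0 : ‖A0‖ ≤ M) (p : Polynomial ℂ) :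
    ∃ K, NB e (aeval A1 p - aeval A0 p) K := by
  induction p using Polynomial.induction_on' with
  | add q r hq hr =>
    obtain ⟨K, hK⟩ := hq
    obtain ⟨L, hL⟩ := hr
    refine ⟨K + L, ?_⟩
    convert hK.add hL using 1
    simp; abel
  | monomial n c =>
    have := (h.pow hM h1 h0 n).smul c
    refine ⟨‖c‖ * (n * M ^ (n - 1) * S), ?_⟩
    convert this using 1
    simp [aeval_monomial, smul_sub, Algebra.smul_def]
    simp [mul_sub]

lemma deriv_poly (φ : ℝ → ℂ) (p : Polynomial ℂ)
    (hφ : ∀ t : ℝ, φ t = Polynomial.eval (t : ℂ) p) (t : ℝ) :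
    deriv φ t = (derivative p).eval (t : ℂ) := by
  have : φ = fun t : ℝ => p.eval (t : ℂ) := funext hφ
  rw [this]
  exact ((p.hasDerivAt (t : ℂ)).comp_ofReal).deriv

end K8

section K9
set_option linter.unusedSectionVars false
set_option linter.unusedSimpArgs false
set_option linter.unusedVariables false
set_option linter.deprecated false
open Filter Topology
variable {H : Type*} [NormedAddCommGroup H] [InnerProductSpace ℂ H] [CompleteSpace H]
variable {ι : Type*} {e : HilbertBasis ι ℂ H}

lemma _root_.HasSum.congr_fun' {κ E : Type*} [AddCommMonoid E] [TopologicalSpace E] {f g : κ → E} {a : E}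
    (h : HasSum f a) (hfg : ∀ n, g n = f n) : HasSum g a := by
  rwa [funext hfg]

lemma hasSum_expder {𝕜 : Type*} [RCLike 𝕜] (z x : 𝕜) :
    HasSum (fun n : ℕ => ((n.factorial : 𝕜)⁻¹ * z ^ n) * ((n : 𝕜) * x ^ (n - 1)))
      (z * NormedSpace.exp (z * x)) := by
  rw [← hasSum_nat_add_iff' 1]
  simp only [Finset.range_one, Finset.sum_singleton, Nat.cast_zero, zero_mul, mul_zero, sub_zero]
  have := (NormedSpace.exp_series_hasSum_exp' (𝕂 := 𝕜) (z * x)).mul_left z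
  refine this.congr_fun' (fun n => ?_)
  have h1 : (n.factorial : 𝕜) ≠ 0 := by exact_mod_cast n.factorial_ne_zero
  have h2 : ((n : 𝕜) + 1) ≠ 0 := by exact_mod_cast n.succ_ne_zero
  rw [Nat.factorial_succ]
  simp only [smul_eq_mul, Nat.add_sub_cancel]
  push_cast
  field_simp
  ring

lemma Eop_trace_aux {A0 A1 : H →L[ℂ] H} {ξ : ℝ → ℝ} {M S : ℝ} (h0 : IsSelfAdjoint A0)
    (h1 : IsSelfAdjoint A1) (hM : 0 ≤ M)
    (hn1 : ‖A1‖ ≤ M) (hn0 : ‖A0‖ ≤ M) (h : NB e (A1 - A0) S) (hi : Integrable ξ)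
    (hz : ∀ x ∉ Set.Icc (-M) M, ξ x = 0)
    (hp : ∀ n : ℕ, HasTr e (A1 ^ n - A0 ^ n) ((∫ x, ((n : ℝ) * x ^ (n - 1)) * ξ x : ℝ) : ℂ))
    (α : ℝ) :
    HasTr e (Eop α A1 - Eop α A0)
      (∫ x : ℝ, (Complex.I * (α : ℂ) * Complex.exp (Complex.I * (α : ℂ) * (x : ℂ))) * (ξ x : ℂ)) ∧
    NB e (Eop α A1 - Eop α A0) (|α| * Real.exp (|α| * M) * S) := by
  set z : ℂ := Complex.I * (α : ℂ) with hzdef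
  have hnz : ‖z‖ = |α| := by simp [hzdef]
  set c : ℕ → ℂ := fun n => (n.factorial : ℂ)⁻¹ * z ^ n with hc
  have hnc : ∀ n, ‖c n‖ = (n.factorial : ℝ)⁻¹ * |α| ^ n := by
    intro n; simp [hc, hnz]
  have hS : HasSum (fun n => c n • (A1 ^ n - A0 ^ n)) (Eop α A1 - Eop α A0) := by
    rw [Eop_eq h1, Eop_eq h0]
    have := (NormedSpace.exp_series_hasSum_exp' (𝕂 := ℂ) (z • A1)).sub
      (NormedSpace.exp_series_hasSum_exp' (𝕂 := ℂ) (z • A0))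
    refine this.congr_fun' (fun n => ?_)
    simp only [hc, _root_.smul_pow, smul_sub, mul_smul]
  have hsum : HasSum (fun n : ℕ => ‖c n‖ * ((n : ℝ) * M ^ (n - 1)))
      (|α| * Real.exp (|α| * M)) := by
    have := hasSum_expder (|α|) M
    rw [Real.exp_eq_exp_ℝ]
    refine this.congr_fun' (fun n => ?_)
    rw [hnc]
  have hN : ∀ n : ℕ, NB e (c n • (A1 ^ n - A0 ^ n)) (‖c n‖ * ((n : ℝ) * M ^ (n - 1) * S)) :=
    fun n => (h.pow hM hn1 hn0 n).smul (c n)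
  have hsum' : HasSum (fun n : ℕ => ‖c n‖ * ((n : ℝ) * M ^ (n - 1) * S))
      (|α| * Real.exp (|α| * M) * S) := by
    simpa only [mul_assoc] using hsum.mul_right S
  have key := HasTr.tsum (fun n => (hp n).smul (c n)) hN hsum'.summable hS
  rw [hsum'.tsum_eq] at key
  refine ⟨?_, key.2⟩
  convert key.1 using 1
  -- the integral
  have hFi : ∀ n : ℕ, Integrable (fun x : ℝ => ((c n) * ((n : ℂ) * (x : ℂ) ^ (n - 1))) * (ξ x : ℂ)) := by
    intro n
    have := (int_mul hi hz (f := fun x => (n : ℝ) * x ^ (n - 1)) (by fun_prop)).ofReal (𝕜 := ℂ)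
    refine (this.const_mul (c n)).congr (Filter.Eventually.of_forall fun x => ?_)
    simp [mul_assoc]
  have hIntg := hasSum_integral_of_summable_integral_norm hFi (by
    refine Summable.of_nonneg_of_le (fun n => integral_nonneg fun x => norm_nonneg _) (fun n => ?_)
      (hsum.summable.mul_right (∫ x, |ξ x|))
    rw [← integral_const_mul]
    refine integral_mono (hFi n).norm (hi.abs.const_mul _) (fun x => ?_)
    simp only [norm_mul, norm_pow, Complex.norm_natCast, Complex.norm_real, Real.norm_eq_abs]
    by_cases hx : x ∈ Set.Icc (-M) M
    · have : |x| ≤ M := abs_le.2 hx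
      gcongr
    · simp [hz x hx])
  have e1 : ∀ x : ℝ, ∑' n : ℕ, ((c n) * ((n : ℂ) * (x : ℂ) ^ (n - 1))) * (ξ x : ℂ) =
      (z * Complex.exp (z * (x : ℂ))) * (ξ x : ℂ) := by
    intro x
    rw [Complex.exp_eq_exp_ℂ]
    exact ((hasSum_expder z (x : ℂ)).mul_right (ξ x : ℂ)).tsum_eq
  simp_rw [e1] at hIntg
  rw [← hIntg.tsum_eq]
  congr 1
  ext n
  rw [← integral_complex_ofReal, ← integral_const_mul]
  congr 1; ext x
  simp [mul_assoc]

lemma Eop_nb {A0 A1 : H →L[ℂ] H} {M S : ℝ} (h0 : IsSelfAdjoint A0)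
    (h1 : IsSelfAdjoint A1)
    (h : ∀ α : ℝ, NB e (Eop α A1 - Eop α A0) (|α| * Real.exp (|α| * M) * S))
    (α : ℝ) : NB e (Eop α A1 - Eop α A0) (|α| * S) := by
  intro C D hC hD s
  have hlim : Tendsto (fun m : ℕ => |α| * Real.exp (|α| / m * M) * S) atTop
      (𝓝 (|α| * Real.exp (0 * M) * S)) := by
    have : Tendsto (fun m : ℕ => |α| / (m : ℝ)) atTop (𝓝 0) :=
      tendsto_const_div_atTop_nhds_zero_nat _
    exact (((Real.continuous_exp.tendsto _).comp (this.mul_const M)).const_mul _).mul_const _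
  simp only [zero_mul, Real.exp_zero, mul_one] at hlim
  refine ge_of_tendsto hlim ?_
  filter_upwards [eventually_gt_atTop 0] with m hm
  have := (h (α / m)).pow zero_le_one (Eop_norm _) (Eop_norm _) m
  rw [Eop_pow h1 α m hm.ne', Eop_pow h0 α m hm.ne'] at this
  refine (this C D hC hD s).trans (le_of_eq ?_)
  have hm' : (m : ℝ) ≠ 0 := by exact_mod_cast hm.ne'
  rw [abs_div, Nat.abs_cast]
  field_simp
  simp

end K9

section K10
set_option linter.unusedSectionVars false
set_option linter.unusedSimpArgs false
set_option linter.unusedVariables false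
set_option linter.deprecated false
open Filter Topology
variable {H : Type*} [NormedAddCommGroup H] [InnerProductSpace ℂ H] [CompleteSpace H]
variable {ι : Type*} {e : HilbertBasis ι ℂ H}

/-- the functional `T ↦ ∑ ⟪e i, C T D e i⟫` -/
noncomputable def PhiL (e : HilbertBasis ι ℂ H) (C D : H →L[ℂ] H) (s : Finset ι) :
    (H →L[ℂ] H) →L[ℂ] ℂ :=
  ∑ i ∈ s, ((innerSL ℂ (e i)).comp C).comp (ContinuousLinearMap.apply ℂ H (D (e i)))

lemma PhiL_apply (C D T : H →L[ℂ] H) (s : Finset ι) :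
    PhiL e C D s T = ∑ i ∈ s, ⟪e i, C (T (D (e i)))⟫_ℂ := by
  simp [PhiL]

lemma NB.integral {F : ℝ → H →L[ℂ] H} {B : ℝ → ℝ} (hF : Integrable F) (hB : Integrable B)
    (h : ∀ α, NB e (F α) (B α)) : NB e (∫ α, F α) (∫ α, B α) := by
  intro C D hC hD s
  rw [← PhiL_apply, ← ContinuousLinearMap.integral_comp_comm _ hF]
  refine norm_integral_le_of_norm_le hB (Filter.Eventually.of_forall fun α => ?_)
  rw [PhiL_apply]
  exact h α C D hC hD s

lemma HasTr.integral [Countable ι] {F : ℝ → H →L[ℂ] H} {B : ℝ → ℝ} {t : ℝ → ℂ}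
    (hF : Integrable F) (hB : Integrable B)
    (h : ∀ α, NB e (F α) (B α)) (ht : ∀ α, HasTr e (F α) (t α)) :
    HasTr e (∫ α, F α) (∫ α, t α) := by
  unfold HasTr HasSum
  have e1 : ∀ s : Finset ι, ∑ i ∈ s, ⟪e i, (∫ α, F α) (e i)⟫_ℂ =
      ∫ α, PhiL e 1 1 s (F α) := by
    intro s
    rw [ContinuousLinearMap.integral_comp_comm _ hF, PhiL_apply]
    simp
  simp only [e1]
  refine tendsto_integral_filter_of_dominated_convergence B
    (Filter.Eventually.of_forall fun s => ?_) (Filter.Eventually.of_forall fun s => ?_) hB ?_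
  · exact ((PhiL e 1 1 s).integrable_comp hF).aestronglyMeasurable
  · refine Filter.Eventually.of_forall fun α => ?_
    rw [PhiL_apply]
    exact h α 1 1 ContinuousLinearMap.norm_id_le ContinuousLinearMap.norm_id_le s
  · refine Filter.Eventually.of_forall fun α => ?_
    simp only [PhiL_apply]
    exact ht α

lemma fc_C11 {A : H →L[ℂ] H} (h : IsSelfAdjoint A) {g : ℝ → ℂ} (hg : Integrable g)
    {φ : ℝ → ℂ}
    (hφ : ∀ β : ℝ, φ β = ∫ α : ℝ, g α * Complex.exp (Complex.I * (α : ℂ) * (β : ℂ))) :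
    Integrable (fun α => g α • Eop α A) ∧ fc φ A = ∫ α, g α • Eop α A := by
  have hn := h.isStarNormal
  let f0 : ℝ → ℂ → ℂ := fun α z => Complex.exp (Complex.I * (α : ℂ) * (z.re : ℂ))
  let f : ℝ → ℂ → ℂ := fun α z => g α * f0 α z
  have hc0 : ∀ α, Continuous (f0 α) := fun α => by fun_prop
  have hc : ∀ α, Continuous (f α) := fun α => by fun_prop
  have hE : ∀ α, cfc (f α) A = g α • Eop α A := by
    intro α
    exact cfc_const_mul (g α) (f0 α) A (hc0 α).continuousOn
  have hmk : ∀ α, ContinuousMap.mkD ((spectrum ℂ A).domRestrict (f α)) 0 =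
      g α • ContinuousMap.mkD ((spectrum ℂ A).domRestrict (f0 α)) 0 := by
    intro α
    ext z
    rw [ContinuousMap.mkD_apply_of_continuousOn (hc α).continuousOn, ContinuousMap.smul_apply,
      ContinuousMap.mkD_apply_of_continuousOn (hc0 α).continuousOn]
    rfl
  have hm : AEStronglyMeasurable
      (fun α => ContinuousMap.mkD ((spectrum ℂ A).domRestrict (f0 α)) 0) (volume : Measure ℝ) := by
    refine ContinuousMap.aeStronglyMeasurable_mkD_restrict_of_uncurry _ _ ?_
    apply Continuous.continuousOn
    show Continuous fun p : ℝ × ℂ => Complex.exp (Complex.I * (p.1 : ℂ) * (p.2.re : ℂ))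
    fun_prop
  have hI : Integrable (fun α => ContinuousMap.mkD ((spectrum ℂ A).domRestrict (f α)) 0) := by
    simp_rw [hmk]
    refine Integrable.mono' hg.norm (hg.aestronglyMeasurable.smul hm)
      (Filter.Eventually.of_forall fun α => ?_)
    rw [norm_smul]
    refine mul_le_of_le_one_right (norm_nonneg _) ?_
    rw [ContinuousMap.norm_le _ zero_le_one]
    intro z
    rw [ContinuousMap.mkD_apply_of_continuousOn (hc0 α).continuousOn]
    show ‖Complex.exp _‖ ≤ 1
    rw [Complex.norm_exp]
    simp
  have h1 := integrable_cfc' f A hI hn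
  have h2 := cfc_integral' f A (Filter.Eventually.of_forall fun α => (hc α).continuousOn) hI hn
  simp only [hE] at h1 h2
  refine ⟨h1, ?_⟩
  rw [← h2]
  unfold fc
  congr 1
  ext z
  exact hφ z.re

lemma C11_deriv {g : ℝ → ℂ} (hg : Integrable g) (hg' : Integrable fun α : ℝ => (α : ℂ) * g α)
    {φ : ℝ → ℂ}
    (hφ : ∀ β : ℝ, φ β = ∫ α : ℝ, g α * Complex.exp (Complex.I * (α : ℂ) * (β : ℂ))) (x : ℝ) :
    deriv φ x = ∫ α : ℝ, g α *
      (Complex.I * (α : ℂ) * Complex.exp (Complex.I * (α : ℂ) * (x : ℂ))) := by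
  have hφ' : φ = fun β : ℝ => ∫ α : ℝ, g α * Complex.exp (Complex.I * (α : ℂ) * (β : ℂ)) :=
    funext hφ
  rw [hφ']
  have hne : ∀ (α β : ℝ), ‖Complex.exp (Complex.I * (α : ℂ) * (β : ℂ))‖ ≤ 1 := by
    intro α β
    rw [Complex.norm_exp]; simp
  refine (hasDerivAt_integral_of_dominated_loc_of_deriv_le (𝕜 := ℝ) (s := Set.univ)
    (F' := fun (β α : ℝ) => g α *
      (Complex.I * (α : ℂ) * Complex.exp (Complex.I * (α : ℂ) * (β : ℂ))))
    (bound := fun α : ℝ => ‖(α : ℂ) * g α‖) Filter.univ_mem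
    (Filter.Eventually.of_forall fun β => ?_) ?_ ?_ (Filter.Eventually.of_forall fun α β _ => ?_)
    hg'.norm (Filter.Eventually.of_forall fun α β _ => ?_)).2.deriv
  · exact hg.aestronglyMeasurable.mul (by fun_prop)
  · refine hg.mul_bdd (c := 1) (by fun_prop) (Filter.Eventually.of_forall fun α => hne _ _)
  · exact hg.aestronglyMeasurable.mul (by fun_prop)
  · simp only [norm_mul, Complex.norm_I, one_mul]
    have := hne α β
    nlinarith [mul_nonneg (norm_nonneg (g α)) (norm_nonneg (α : ℂ))]
  · have h1 : HasDerivAt (fun w : ℂ => Complex.exp (Complex.I * (α : ℂ) * w))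
        (Complex.exp (Complex.I * (α : ℂ) * (β : ℂ)) * (Complex.I * (α : ℂ) * 1)) (β : ℂ) :=
      ((hasDerivAt_id (β : ℂ)).const_mul _).cexp
    have h2 := (h1.comp_ofReal).const_mul (g α)
    exact h2.congr_deriv (by ring)

lemma C11_main [Countable ι] {A0 A1 : H →L[ℂ] H} {ξ : ℝ → ℝ} {S : ℝ}
    (h0 : IsSelfAdjoint A0) (h1 : IsSelfAdjoint A1) (hi : Integrable ξ)
    (hN : ∀ α : ℝ, NB e (Eop α A1 - Eop α A0) (|α| * S))
    (hT : ∀ α : ℝ, HasTr e (Eop α A1 - Eop α A0)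
      (∫ x : ℝ, (Complex.I * (α : ℂ) * Complex.exp (Complex.I * (α : ℂ) * (x : ℂ))) * (ξ x : ℂ)))
    {g : ℝ → ℂ} (hg : Integrable g) (hg' : Integrable fun α : ℝ => (α : ℂ) * g α)
    {φ : ℝ → ℂ}
    (hφ : ∀ β : ℝ, φ β = ∫ α : ℝ, g α * Complex.exp (Complex.I * (α : ℂ) * (β : ℂ))) :
    (∃ K, NB e (fc φ A1 - fc φ A0) K) ∧
      HasTr e (fc φ A1 - fc φ A0) (∫ x, deriv φ x * (ξ x : ℂ)) := by
  obtain ⟨i1, e1⟩ := fc_C11 h1 hg hφ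
  obtain ⟨i0, e0⟩ := fc_C11 h0 hg hφ
  have hD : fc φ A1 - fc φ A0 = ∫ α, g α • (Eop α A1 - Eop α A0) := by
    rw [e1, e0, ← integral_sub i1 i0]
    simp only [smul_sub]
  have hF : Integrable fun α => g α • (Eop α A1 - Eop α A0) := by
    simp only [smul_sub]
    exact i1.sub i0
  have hB : Integrable fun α : ℝ => ‖g α‖ * (|α| * S) := by
    refine (hg'.norm.mul_const S).congr (Filter.Eventually.of_forall fun α => ?_)
    simp; ring
  have hN' : ∀ α, NB e (g α • (Eop α A1 - Eop α A0)) (‖g α‖ * (|α| * S)) :=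
    fun α => (hN α).smul (g α)
  refine ⟨⟨_, hD ▸ NB.integral hF hB hN'⟩, ?_⟩
  have := HasTr.integral hF hB hN' (fun α => (hT α).smul (g α))
  rw [hD]
  convert this using 1
  simp_rw [C11_deriv hg hg' hφ, ← integral_const_mul, ← integral_mul_const]
  rw [integral_integral_swap]
  · congr 1; ext α
    congr 1; ext x
    ring
  · have hb : Integrable (fun q : ℝ × ℝ => (ξ q.1 : ℂ) * ((q.2 : ℂ) * g q.2))
        ((volume : Measure ℝ).prod volume) := (hi.ofReal (𝕜 := ℂ)).mul_prod hg'
    have := hb.bdd_mul (c := 1)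
      (f := fun q : ℝ × ℝ => Complex.I * Complex.exp (Complex.I * (q.2 : ℂ) * (q.1 : ℂ)))
      (by
        apply Continuous.aestronglyMeasurable
        fun_prop) (Filter.Eventually.of_forall fun q => by
          rw [norm_mul, Complex.norm_exp]; simp)
    refine this.congr (Filter.Eventually.of_forall fun q => ?_)
    simp only [Function.uncurry]
    ring

end K10

theorem statement8 {ι : Type*} (e : HilbertBasis ι ℂ H) (A0 A1 : H →L[ℂ] H)
    (a b : ℝ) (h0 : IsSelfAdjoint A0) (h1 : IsSelfAdjoint A1)
    (hV : IsTraceClass e (A1 - A0))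
    (hs0 : spectrum ℝ A0 ⊆ Set.Icc a b) (hs1 : spectrum ℝ A1 ⊆ Set.Icc a b) :
    ∃ ξ : ℝ → ℝ, Integrable ξ ∧ (∀ t : ℝ, t ∉ Set.Icc a b → ξ t = 0) ∧
      (∀ φ : ℝ → ℂ, GoodFun φ → IsTraceClass e (fc φ A1 - fc φ A0) ∧
        trace e (fc φ A1 - fc φ A0) = ∫ t in Set.Icc a b, deriv φ t * (ξ t : ℂ)) ∧
      (∫ t in Set.Icc a b, |ξ t|) ≤ traceNorm e (A1 - A0) ∧
      Complex.ofReal (∫ t in Set.Icc a b, ξ t) = trace e (A1 - A0) ∧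
      ((A1 - A0).IsPositive →
        ∀ᵐ t ∂(volume : Measure ℝ), t ∈ Set.Icc a b → 0 ≤ ξ t) ∧
      ((-(A1 - A0)).IsPositive →
        ∀ᵐ t ∂(volume : Measure ℝ), t ∈ Set.Icc a b → ξ t ≤ 0) ∧
      ∀ ξ' : ℝ → ℝ, Integrable ξ' → (∀ t : ℝ, t ∉ Set.Icc a b → ξ' t = 0) →
        (∀ φ : ℝ → ℂ, GoodFun φ →
          trace e (fc φ A1 - fc φ A0) = ∫ t in Set.Icc a b, deriv φ t * (ξ' t : ℂ)) →
        ξ' =ᵐ[volume] ξ := by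
  obtain ⟨ξ, M, hM, hn0, hn1, hNB, hi, hzM, hz, hL1, hpos, hneg, hpow⟩ :=
    xi_exists' h0 h1 hV hs0 hs1
  have hcount : Countable ι := basis_countable e
  have hset : ∀ (η : ℝ → ℝ), (∀ t : ℝ, t ∉ Set.Icc a b → η t = 0) → ∀ f : ℝ → ℂ,
      ∫ t in Set.Icc a b, f t * (η t : ℂ) = ∫ t, f t * (η t : ℂ) := by
    intro η hη f
    apply setIntegral_eq_integral_of_forall_compl_eq_zero
    intro x hx
    simp [hη x hx]
  have hgood : ∀ φ : ℝ → ℂ, GoodFun φ → IsTraceClass e (fc φ A1 - fc φ A0) ∧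
        trace e (fc φ A1 - fc φ A0) = ∫ t in Set.Icc a b, deriv φ t * (ξ t : ℂ) := by
    intro φ hφ
    rw [hset ξ hz]
    suffices hh : (∃ K, NB e (fc φ A1 - fc φ A0) K) ∧
        HasTr e (fc φ A1 - fc φ A0) (∫ x, deriv φ x * (ξ x : ℂ)) by
      obtain ⟨⟨K, hK⟩, hT⟩ := hh
      exact ⟨hK.isTraceClass, hT.tsum_eq⟩
    rcases hφ with ⟨g, hg, hg', hφ⟩ | ⟨p, hp⟩
    · have haux := fun α : ℝ => Eop_trace_aux h0 h1 hM hn1 hn0 hNB hi hzM hpow α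
      have hN := Eop_nb h0 h1 (fun α => (haux α).2)
      refine C11_main h0 h1 hi hN (fun α => (haux α).1)
        (g := fun α => (((Real.sqrt (2 * Real.pi))⁻¹ : ℝ) : ℂ) * g α) (hg.const_mul _) ?_ ?_
      · refine (hg'.const_mul (((Real.sqrt (2 * Real.pi))⁻¹ : ℝ) : ℂ)).congr
          (Filter.Eventually.of_forall fun α => ?_)
        simp only [Complex.real_smul]
        ring
      · intro β
        rw [hφ β, ← integral_smul]
        congr 1
        ext α
        simp only [Complex.real_smul, smul_eq_mul]
        ring
    · rw [fc_poly h1 φ p hp, fc_poly h0 φ p hp]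
      refine ⟨nb_cpoly hNB hM hn1 hn0 p, ?_⟩
      simp_rw [deriv_poly φ p hp]
      exact hasTr_cpoly hi hz hpow p
  refine ⟨ξ, hi, hz, hgood, ?_, ?_, ?_, ?_, ?_⟩
  · rw [setIntegral_eq_integral_of_forall_compl_eq_zero (fun x hx => by simp [hz x hx])]
    exact hL1
  · rw [setIntegral_eq_integral_of_forall_compl_eq_zero (fun x hx => hz x hx)]
    have := (hpow 1).tsum_eq
    simp only [pow_one, Nat.cast_one, Nat.sub_self, pow_zero, mul_one, one_mul] at this
    exact this.symm
  · intro hp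
    exact Filter.Eventually.of_forall fun t _ => hpos hp t
  · intro hp
    exact Filter.Eventually.of_forall fun t _ => hneg hp t
  · intro ξ' hi' hz' hφ'
    refine xi_unique hi hi' hz hz' (fun n => ?_)
    have hpoly : ∀ t : ℝ, (fun t : ℝ => ((t : ℂ)) ^ n) t =
        Polynomial.eval (t : ℂ) ((X : Polynomial ℂ) ^ n) := fun t => by simp
    have hG : GoodFun (fun t : ℝ => ((t : ℂ)) ^ n) := Or.inr ⟨X ^ n, hpoly⟩
    have h3 := (hφ' _ hG).symm.trans (hgood _ hG).2
    rw [hset ξ hz, hset ξ' hz'] at h3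
    simp_rw [deriv_poly _ _ hpoly] at h3
    have h4 : ∀ η : ℝ → ℝ, ∫ x : ℝ, (derivative ((X : Polynomial ℂ) ^ n)).eval (x : ℂ) * (η x : ℂ) =
        ((∫ x, ((n : ℝ) * x ^ (n - 1)) * η x : ℝ) : ℂ) := by
      intro η
      rw [← integral_complex_ofReal]
      congr 1
      ext x
      simp [derivative_X_pow]
    rw [h4, h4] at h3
    exact_mod_cast h3

end HHCP
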